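/- arXiv:2311.03013 — 4 statements merged into one kernel-verified Lean document; each statement's English description precedes it below -/
import Mathlib

section
/- Let F(z) = Σ_{n=0}^∞ c_n z^n be analytic on the open unit disc 𝔻 with real coefficients c_n, and set U(z) = Re F(z). Assume U has L¹_loc-boundary behavior on ∂𝔻∖{1}, and assume there exists θ₀ ∈ (0,π) such that sup_{0<r<1} ∫_{−θ₀}^{θ₀} |U(re^{iθ})| dθ < ∞. Then the sequence (c_n) converges, and its limit equals lim_{r→1⁻} (1−r) U(r). -/
open MeasureTheory Filter Set

/-- `U` (defined on the open unit disc) has `L¹_loc`-boundary behavior on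
`∂𝔻 ∖ {1}` (boundary points parametrized as `e^{iθ}`, `θ ∈ [-π,π] ∖ {0}`). -/
def L1locBoundaryBehaviorDisc (U : ℂ → ℝ) : Prop :=
  ∃ f : ℝ → ℝ, ∀ a b : ℝ, -Real.pi ≤ a → a ≤ b → b ≤ Real.pi → (0 : ℝ) ∉ Icc a b →
    IntegrableOn f (Icc a b) ∧
    Tendsto (fun r : ℝ => ∫ θ in a..b, |U (r * Complex.exp (θ * Complex.I)) - f θ|)
      (nhdsWithin 1 (Iio 1)) (nhds 0)

open Real in
lemma aux_cos_orth (m n : ℕ) (hn : 1 ≤ n) :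
    ∫ θ in (0:ℝ)..π, cos (m * θ) * cos (n * θ) = if m = n then π / 2 else 0 := by
  have key : ∀ k : ℤ, k ≠ 0 → ∫ θ in (0:ℝ)..π, cos (k * θ) = 0 := by
    intro k hk
    have hk' : (k : ℝ) ≠ 0 := by exact_mod_cast hk
    rw [intervalIntegral.integral_comp_mul_left (fun x => cos x) hk']
    simp [Real.sin_int_mul_pi]
  have h1 : ∀ θ : ℝ, cos (m * θ) * cos (n * θ)
      = (1/2) * (cos (((m - n : ℤ) : ℝ) * θ) + cos (((m + n : ℤ) : ℝ) * θ)) := by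
    intro θ
    push_cast
    rw [sub_mul, add_mul, cos_sub, cos_add]; ring
  simp_rw [h1]
  rw [intervalIntegral.integral_const_mul, intervalIntegral.integral_add
    (Continuous.intervalIntegrable (by fun_prop) _ _)
    (Continuous.intervalIntegrable (by fun_prop) _ _), key (m + n) (by omega)]
  split_ifs with h
  · subst h; simp; ring
  · rw [key (m - n) (by omega)]; simp

lemma aux_abel (c : ℕ → ℝ) (a : ℝ) (S : ℝ → ℝ)
    (hS : ∀ r ∈ Ioo (0:ℝ) 1, HasSum (fun n => c n * r ^ n) (S r))
    (hc : Tendsto c atTop (nhds a)) :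
    Tendsto (fun r : ℝ => (1 - r) * S r) (nhdsWithin 1 (Iio 1)) (nhds a) := by
  let d : ℕ → ℝ := fun n => c n - (if n = 0 then 0 else c (n - 1))
  have hd : ∀ n, ∑ i ∈ Finset.range (n + 1), d i = c n := by
    intro n
    induction n with
    | zero => simp [d]
    | succ k ih => rw [Finset.sum_range_succ, ih]; simp [d]
  have h1 : Tendsto (fun n => ∑ i ∈ Finset.range n, d i) atTop (nhds a) := by
    rw [← tendsto_add_atTop_iff_nat 1]
    simpa only [hd] using hc
  have h2 := Real.tendsto_tsum_powerSeries_nhdsWithin_lt h1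
  refine h2.congr' ?_
  have : Ioo (0:ℝ) 1 ∈ nhdsWithin (1:ℝ) (Iio 1) := Ioo_mem_nhdsLT (by norm_num)
  filter_upwards [this] with r hr
  have hs := hS r hr
  have hsh : HasSum (fun n : ℕ => (if n = 0 then 0 else c (n - 1)) * r ^ n) (r * S r) := by
    rw [← hasSum_nat_add_iff' 1]
    have := hs.mul_left r
    simp only [Nat.add_eq_zero_iff, one_ne_zero, and_false, if_false, Nat.add_sub_cancel,
      Finset.range_one, Finset.sum_singleton, if_true, zero_mul, sub_zero]
    refine this.congr_fun ?_ |> fun h => h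
    intro n; ring
  have := hs.sub hsh
  have h3 : HasSum (fun n => d n * r ^ n) ((1 - r) * S r) := by
    have e : (1 - r) * S r = S r - r * S r := by ring
    rw [e]
    refine this.congr_fun ?_ |> fun h => h
    intro n; simp only [d]; ring
  exact h3.tsum_eq

open Real in
lemma aux_RL (f : ℝ → ℝ) (hf : IntegrableOn f (Ioc 0 π)) :
    Tendsto (fun n : ℕ => ∫ θ in (0:ℝ)..π, f θ * cos (n * θ)) atTop (nhds 0) := by
  let g : ℝ → ℂ := (Ioc 0 π).indicator (fun x => (f x : ℂ))
  have h := Real.tendsto_integral_exp_smul_cocompact g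
  have hw : Tendsto (fun n : ℕ => (n : ℝ) / (2 * π)) atTop (cocompact ℝ) := by
    refine Tendsto.mono_right ?_ atTop_le_cocompact
    exact tendsto_natCast_atTop_atTop.atTop_div_const (by positivity)
  have h2 := (Complex.continuous_re.tendsto _).comp (h.comp hw)
  simp only [Complex.zero_re] at h2
  refine h2.congr ?_
  intro n
  simp only [Function.comp]
  rw [intervalIntegral.integral_of_le pi_pos.le]
  have e1 : ∀ v : ℝ, Real.fourierChar (-(v * ((n:ℝ) / (2 * π)))) • g v =
      (Ioc 0 π).indicator (fun x => Complex.exp (((-(n * x) : ℝ) : ℂ) * Complex.I) * (f x : ℂ)) v := by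
    intro v
    by_cases hv : v ∈ Ioc 0 π
    · simp only [g, indicator_of_mem hv, Circle.smul_def, Real.fourierChar_apply, smul_eq_mul]
      congr 3
      have := pi_ne_zero
      norm_cast
      field_simp
    · simp [g, indicator_of_notMem hv]
  simp_rw [e1]
  rw [integral_indicator measurableSet_Ioc]
  have hint : IntegrableOn (fun x => Complex.exp (((-(n * x) : ℝ) : ℂ) * Complex.I) * (f x : ℂ)) (Ioc 0 π) := by
    refine Integrable.bdd_mul (c := 1) hf.ofReal ?_ ?_
    · exact Continuous.aestronglyMeasurable (by fun_prop)
    · refine Eventually.of_forall fun x => ?_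
      rw [Complex.norm_exp_ofReal_mul_I]
  have := integral_re hint
  simp only [RCLike.re_eq_complex_re] at this
  rw [← this]
  refine integral_congr_ae (Eventually.of_forall fun x => ?_)
  simp only [Complex.re_mul_ofReal, Complex.exp_ofReal_mul_I_re, cos_neg]
  ring

lemma aux_fourier (c : ℕ → ℝ) (u : ℝ → ℝ) (r : ℝ) (hr : r ∈ Ioo (0:ℝ) 1)
    (hs : Summable (fun n => |c n * r ^ n|))
    (hu : ∀ θ, HasSum (fun n : ℕ => c n * r ^ n * Real.cos (n * θ)) (u θ)) (n : ℕ) (hn : 1 ≤ n) :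
    ∫ θ in (0:ℝ)..Real.pi, u θ * Real.cos (n * θ) = c n * r ^ n * (Real.pi / 2) := by
  have h := intervalIntegral.hasSum_integral_of_dominated_convergence (μ := volume)
    (a := 0) (b := Real.pi)
    (F := fun (m : ℕ) (θ : ℝ) => c m * r ^ m * Real.cos (m * θ) * Real.cos (n * θ))
    (f := fun θ => u θ * Real.cos (n * θ)) (bound := fun m _ => |c m * r ^ m|)
    (fun m => Continuous.aestronglyMeasurable (by fun_prop))
    (fun m => Eventually.of_forall fun θ _ => by
      rw [norm_mul, norm_mul, mul_assoc, Real.norm_eq_abs]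
      refine mul_le_of_le_one_right (abs_nonneg _) ?_
      exact mul_le_one₀ (Real.abs_cos_le_one _) (norm_nonneg _) (Real.abs_cos_le_one _))
    (Eventually.of_forall fun θ _ => hs)
    (by simp)
    (Eventually.of_forall fun θ _ => (hu θ).mul_right _)
  simp_rw [mul_assoc (c _ * r ^ _), intervalIntegral.integral_const_mul, aux_cos_orth _ n hn] at h
  refine h.unique ?_
  have := hasSum_ite_eq n (c n * r ^ n * (Real.pi / 2))
  refine this.congr_fun ?_ |> fun h => h
  intro m
  split_ifs with h
  · rw [h]
  · simp

open Real in
lemma aux_L1 (u : ℝ → ℝ → ℝ) (f : ℝ → ℝ) (M θ₀ : ℝ) (hM : 0 ≤ M) (h0 : 0 < θ₀) (h1 : θ₀ < π)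
    (hc : ∀ r ∈ Ioo (0:ℝ) 1, Continuous (u r))
    (hb : ∀ r ∈ Ioo (0:ℝ) 1, ∫ θ in (0:ℝ)..θ₀, |u r θ| ≤ M)
    (hf : ∀ a b : ℝ, 0 < a → a ≤ b → b ≤ π → IntegrableOn f (Icc a b) ∧
      Tendsto (fun r : ℝ => ∫ θ in a..b, |u r θ - f θ|) (nhdsWithin 1 (Iio 1)) (nhds 0)) :
    IntegrableOn f (Ioc 0 π) ∧
    Tendsto (fun r : ℝ => ∫ θ in (0:ℝ)..π, |u r θ - f θ| * θ) (nhdsWithin 1 (Iio 1)) (nhds 0) := by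
  have hIoo : Ioo (0:ℝ) 1 ∈ nhdsWithin (1:ℝ) (Iio 1) := Ioo_mem_nhdsLT (by norm_num)
  have hii : ∀ a b : ℝ, 0 < a → a ≤ b → b ≤ π → IntervalIntegrable f volume a b := by
    intro a b ha hab hb
    rw [intervalIntegrable_iff_integrableOn_Icc_of_le hab]
    exact (hf a b ha hab hb).1
  have hbound : ∀ a : ℝ, 0 < a → a ≤ θ₀ → ∫ θ in a..θ₀, |f θ| ≤ M := by
    intro a ha haθ
    have ht := ((hf a θ₀ ha haθ h1.le).2).add_const M
    rw [zero_add] at ht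
    refine ge_of_tendsto ht ?_
    filter_upwards [hIoo] with r hr
    have hcu := hc r hr
    have hfi := hii a θ₀ ha haθ h1.le
    have hui : ∀ x y, IntervalIntegrable (u r) volume x y := fun x y => hcu.intervalIntegrable x y
    have hle : ∫ θ in a..θ₀, |u r θ| ≤ M := by
      refine le_trans ?_ (hb r hr)
      exact intervalIntegral.integral_mono_interval ha.le haθ le_rfl
        (Eventually.of_forall fun x => abs_nonneg _) (hui 0 θ₀).abs
    calc ∫ θ in a..θ₀, |f θ| ≤ ∫ θ in a..θ₀, (|u r θ - f θ| + |u r θ|) := by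
          refine intervalIntegral.integral_mono_on haθ hfi.abs
            (((hui _ _).sub hfi).abs.add (hui _ _).abs) ?_
          intro x _
          have := abs_sub_abs_le_abs_sub (f x) (u r x)
          rw [abs_sub_comm] at this
          linarith
      _ = (∫ θ in a..θ₀, |u r θ - f θ|) + ∫ θ in a..θ₀, |u r θ| :=
          intervalIntegral.integral_add ((hui _ _).sub hfi).abs (hui _ _).abs
      _ ≤ _ := by gcongr
  have hint0 : IntegrableOn f (Ioc 0 θ₀) := by
    refine integrableOn_Ioc_of_intervalIntegral_norm_bounded_left (l := atTop)
      (a := fun n : ℕ => θ₀ / ((n:ℝ) + 1)) (I := M) ?_ ?_ ?_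
    · intro n
      refine ((hf (θ₀ / ((n:ℝ) + 1)) θ₀ (by positivity) ?_ h1.le).1).mono_set Ioc_subset_Icc_self
      exact div_le_self h0.le (by linarith [n.cast_nonneg (α := ℝ)])
    · exact tendsto_const_nhds.div_atTop
        (tendsto_atTop_add_const_right _ _ tendsto_natCast_atTop_atTop)
    · refine Eventually.of_forall fun n => ?_
      have hle : θ₀ / ((n:ℝ) + 1) ≤ θ₀ := div_le_self h0.le (by linarith [n.cast_nonneg (α := ℝ)])
      have := hbound (θ₀ / ((n:ℝ) + 1)) (by positivity) hle
      rwa [intervalIntegral.integral_of_le hle] at this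
  have hint : IntegrableOn f (Ioc 0 π) := by
    rw [← Ioc_union_Ioc_eq_Ioc h0.le h1.le]
    exact hint0.union (((hf θ₀ π h0 h1.le le_rfl).1).mono_set Ioc_subset_Icc_self)
  refine ⟨hint, ?_⟩
  have hI : IntervalIntegrable f volume 0 π := by
    rwa [intervalIntegrable_iff_integrableOn_Ioc_of_le pi_pos.le]
  have hsub : ∀ x y, 0 ≤ x → x ≤ y → y ≤ π → IntervalIntegrable f volume x y := by
    intro x y hx hxy hy
    refine hI.mono_set ?_
    rw [uIcc_of_le hxy, uIcc_of_le pi_pos.le]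
    exact Icc_subset_Icc hx hy
  set K : ℝ := M + ∫ θ in (0:ℝ)..π, |f θ| with hK
  have hK0 : 0 ≤ K := add_nonneg hM
    (intervalIntegral.integral_nonneg pi_pos.le fun x _ => abs_nonneg _)
  have hmain : ∀ δ, 0 < δ → δ ≤ θ₀ → ∀ r ∈ Ioo (0:ℝ) 1,
      ∫ θ in (0:ℝ)..π, |u r θ - f θ| * θ ≤ K * δ + (∫ θ in δ..π, |u r θ - f θ|) * π := by
    intro δ hδ hδ' r hr
    have hcu := hc r hr
    have hui : ∀ x y, IntervalIntegrable (u r) volume x y := fun x y => hcu.intervalIntegrable x y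
    have hδπ : δ ≤ π := hδ'.trans h1.le
    have A1 : IntervalIntegrable (fun θ => |u r θ - f θ|) volume 0 δ :=
      ((hui _ _).sub (hsub 0 δ le_rfl hδ.le hδπ)).abs
    have A2 : IntervalIntegrable (fun θ => |u r θ - f θ|) volume δ π :=
      ((hui _ _).sub (hsub δ π hδ.le hδπ le_rfl)).abs
    have B1 := A1.mul_continuousOn (g := fun θ => θ) continuousOn_id
    have B2 := A2.mul_continuousOn (g := fun θ => θ) continuousOn_id
    rw [← intervalIntegral.integral_add_adjacent_intervals B1 B2]
    refine add_le_add ?_ ?_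
    · calc ∫ θ in (0:ℝ)..δ, |u r θ - f θ| * θ ≤ ∫ θ in (0:ℝ)..δ, (|u r θ| + |f θ|) * δ := by
            refine intervalIntegral.integral_mono_on hδ.le B1
              (((hui _ _).abs.add (hsub 0 δ le_rfl hδ.le hδπ).abs).mul_const _) ?_
            intro x hx
            exact mul_le_mul (abs_sub _ _) hx.2 hx.1 (by positivity)
        _ = ((∫ θ in (0:ℝ)..δ, |u r θ|) + ∫ θ in (0:ℝ)..δ, |f θ|) * δ := by
            rw [intervalIntegral.integral_mul_const, intervalIntegral.integral_add
              (hui _ _).abs (hsub 0 δ le_rfl hδ.le hδπ).abs]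
        _ ≤ K * δ := by
            refine mul_le_mul_of_nonneg_right (add_le_add ?_ ?_) hδ.le
            · refine le_trans ?_ (hb r hr)
              exact intervalIntegral.integral_mono_interval le_rfl hδ.le hδ'
                (Eventually.of_forall fun x => abs_nonneg _) (hui 0 θ₀).abs
            · exact intervalIntegral.integral_mono_interval le_rfl hδ.le hδπ
                (Eventually.of_forall fun x => abs_nonneg _) hI.abs
    · rw [← intervalIntegral.integral_mul_const]
      refine intervalIntegral.integral_mono_on hδπ B2 (A2.mul_const _) ?_
      intro x hx
      exact mul_le_mul_of_nonneg_left hx.2 (abs_nonneg _)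
  rw [Metric.tendsto_nhds]
  intro ε hε
  set δ := min θ₀ (ε / (2 * (K + 1))) with hδdef
  have hδ : 0 < δ := lt_min h0 (by positivity)
  have hKδ : K * δ < ε / 2 := by
    have : δ ≤ ε / (2 * (K + 1)) := min_le_right _ _
    have h2 : δ * (2 * (K + 1)) ≤ ε := by rwa [le_div_iff₀ (by positivity)] at this
    nlinarith
  have ht := ((hf δ π hδ ((min_le_left _ _).trans h1.le) le_rfl).2).mul_const π
  rw [zero_mul] at ht
  filter_upwards [hIoo, ht.eventually (gt_mem_nhds (half_pos hε))] with r hr hr2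
  have := hmain δ hδ (min_le_left _ _) r hr
  have hnn : 0 ≤ ∫ θ in (0:ℝ)..π, |u r θ - f θ| * θ :=
    intervalIntegral.integral_nonneg pi_pos.le fun x hx => mul_nonneg (abs_nonneg _) hx.1
  rw [Real.dist_eq, sub_zero, abs_of_nonneg hnn]
  linarith

open Real in
lemma aux_lim (u : ℝ → ℝ → ℝ) (f g : ℝ → ℝ) (C : ℝ)
    (hc : ∀ r ∈ Ioo (0:ℝ) 1, Continuous (u r)) (hf : IntegrableOn f (Ioc 0 π))
    (ht : Tendsto (fun r : ℝ => ∫ θ in (0:ℝ)..π, |u r θ - f θ| * θ)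
      (nhdsWithin 1 (Iio 1)) (nhds 0))
    (hg : Continuous g) (hgC : ∀ θ ∈ Icc 0 π, |g θ| ≤ C * θ) :
    Tendsto (fun r : ℝ => ∫ θ in (0:ℝ)..π, u r θ * g θ)
      (nhdsWithin 1 (Iio 1)) (nhds (∫ θ in (0:ℝ)..π, f θ * g θ)) := by
  have hIoo : Ioo (0:ℝ) 1 ∈ nhdsWithin (1:ℝ) (Iio 1) := Ioo_mem_nhdsLT (by norm_num)
  have hI : IntervalIntegrable f volume 0 π := by
    rwa [intervalIntegrable_iff_integrableOn_Ioc_of_le pi_pos.le]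
  rw [tendsto_iff_norm_sub_tendsto_zero]
  have ht2 := ht.const_mul C
  rw [mul_zero] at ht2
  refine squeeze_zero' (Eventually.of_forall fun _ => norm_nonneg _) ?_ ht2
  filter_upwards [hIoo] with r hr
  have hui : IntervalIntegrable (u r) volume 0 π := (hc r hr).intervalIntegrable _ _
  have hm := (hui.sub hI).abs.mul_continuousOn (g := fun θ => θ) continuousOn_id
  rw [← intervalIntegral.integral_sub (hui.mul_continuousOn hg.continuousOn)
    (hI.mul_continuousOn hg.continuousOn), ← intervalIntegral.integral_const_mul]
  refine intervalIntegral.norm_integral_le_of_norm_le pi_pos.le ?_ (hm.const_mul C)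
  refine Eventually.of_forall fun x hx => ?_
  rw [← sub_mul, norm_mul, Real.norm_eq_abs, Real.norm_eq_abs]
  have := mul_le_mul_of_nonneg_left (hgC x ⟨hx.1.le, hx.2⟩) (abs_nonneg (u r x - f x))
  linarith

/-- Theorem 1.4: Tauberian theorem for power series with real coefficients. -/
theorem power_series_tauberian_b2 (c : ℕ → ℝ) (F : ℂ → ℂ)
    (hF : ∀ z : ℂ, ‖z‖ < 1 → HasSum (fun n : ℕ => (c n : ℂ) * z ^ n) (F z))
    (U : ℂ → ℝ) (hU : ∀ z : ℂ, U z = (F z).re)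
    (hbd : L1locBoundaryBehaviorDisc U)
    (θ₀ : ℝ) (hθ₀ : θ₀ ∈ Ioo 0 Real.pi)
    (hsup : ∃ M : ℝ, ∀ r ∈ Ioo (0 : ℝ) 1,
      (∫⁻ θ in Ioo (-θ₀) θ₀, ENNReal.ofReal |U (r * Complex.exp (θ * Complex.I))|)
        ≤ ENNReal.ofReal M) :
    ∃ a : ℝ,
      Tendsto c atTop (nhds a) ∧
      Tendsto (fun r : ℝ => (1 - r) * U r) (nhdsWithin 1 (Iio 1)) (nhds a) := by
  obtain ⟨f, hf⟩ := hbd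
  obtain ⟨M, hM⟩ := hsup
  obtain ⟨h0, h1⟩ := hθ₀
  have hIoo : Ioo (0:ℝ) 1 ∈ nhdsWithin (1:ℝ) (Iio 1) := Ioo_mem_nhdsLT (by norm_num)
  set u : ℝ → ℝ → ℝ := fun r θ => U (r * Complex.exp (θ * Complex.I)) with hu
  have hnorm : ∀ r ∈ Ioo (0:ℝ) 1, ∀ θ : ℝ, ‖(r : ℂ) * Complex.exp (θ * Complex.I)‖ < 1 := by
    intro r hr θ
    rw [norm_mul, Complex.norm_exp_ofReal_mul_I, mul_one, Complex.norm_real, Real.norm_eq_abs,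
      abs_of_pos hr.1]
    exact hr.2
  have hsumu : ∀ r ∈ Ioo (0:ℝ) 1, ∀ θ : ℝ,
      HasSum (fun n : ℕ => c n * r ^ n * Real.cos (n * θ)) (u r θ) := by
    intro r hr θ
    have h := Complex.hasSum_re (hF _ (hnorm r hr θ))
    rw [← hU] at h
    refine h.congr_fun ?_ |> fun h => h
    intro n
    have e : (c n : ℂ) * ((r : ℂ) * Complex.exp (θ * Complex.I)) ^ n
        = ((c n * r ^ n : ℝ) : ℂ) * Complex.exp (((n * θ : ℝ) : ℂ) * Complex.I) := by
      rw [mul_pow, ← Complex.exp_nat_mul]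
      push_cast
      ring_nf
    rw [e, Complex.re_ofReal_mul, Complex.exp_ofReal_mul_I_re]
  have hS : ∀ r ∈ Ioo (0:ℝ) 1, HasSum (fun n => c n * r ^ n) (U r) := by
    intro r hr
    simpa [hu] using hsumu r hr 0
  have habs : ∀ r ∈ Ioo (0:ℝ) 1, Summable (fun n => |c n * r ^ n|) := by
    intro r hr
    exact (hS r hr).summable.abs
  have hc : ∀ r ∈ Ioo (0:ℝ) 1, Continuous (u r) := by
    intro r hr
    have e : u r = fun θ => ∑' n : ℕ, c n * r ^ n * Real.cos (n * θ) := by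
      funext θ; exact (hsumu r hr θ).tsum_eq.symm
    rw [e]
    refine continuous_tsum (fun n => by fun_prop) (habs r hr) ?_
    intro n θ
    rw [norm_mul, Real.norm_eq_abs]
    exact mul_le_of_le_one_right (abs_nonneg _) (Real.abs_cos_le_one _)
  have hb : ∀ r ∈ Ioo (0:ℝ) 1, ∫ θ in (0:ℝ)..θ₀, |u r θ| ≤ max M 0 := by
    intro r hr
    rw [intervalIntegral.integral_of_le h0.le, integral_Ioc_eq_integral_Ioo]
    have hi : IntegrableOn (fun θ => |u r θ|) (Ioo 0 θ₀) :=
      ((hc r hr).abs.integrableOn_Icc (a := 0) (b := θ₀)).mono_set Ioo_subset_Icc_self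
    rw [← ENNReal.ofReal_le_ofReal_iff (le_max_right _ _),
      ofReal_integral_eq_lintegral_ofReal hi (Eventually.of_forall fun _ => abs_nonneg _)]
    refine le_trans (lintegral_mono_set (Ioo_subset_Ioo_left (by linarith))) ((hM r hr).trans ?_)
    exact ENNReal.ofReal_le_ofReal (le_max_left _ _)
  obtain ⟨hint, hlim⟩ := aux_L1 u f (max M 0) θ₀ (le_max_right _ _) h0 h1 hc hb (by
    intro a b ha hab hb
    exact hf a b (by linarith [Real.pi_pos]) hab hb (fun h => by linarith [h.1]))
  have hI : IntervalIntegrable f volume 0 Real.pi := by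
    rwa [intervalIntegrable_iff_integrableOn_Ioc_of_le Real.pi_pos.le]
  have hfc : ∀ n : ℕ, IntervalIntegrable (fun θ => f θ * Real.cos (n * θ)) volume 0 Real.pi :=
    fun n => hI.mul_continuousOn (Continuous.continuousOn (by fun_prop))
  have key : ∀ n : ℕ, 1 ≤ n → (c n - c 1) * (Real.pi / 2) =
      (∫ θ in (0:ℝ)..Real.pi, f θ * Real.cos (n * θ))
        - ∫ θ in (0:ℝ)..Real.pi, f θ * Real.cos ((1:ℕ) * θ) := by
    intro n hn
    have hl := aux_lim u f (fun θ => Real.cos (n * θ) - Real.cos ((1:ℕ) * θ)) (n + 1) hc hint hlim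
      (by fun_prop) (by
        intro θ hθ
        have h := Real.abs_cos_sub_cos_le (n * θ) ((1:ℕ) * θ)
        have hn1 : (1:ℝ) ≤ n := by exact_mod_cast hn
        have h5 : (0:ℝ) ≤ n * θ - 1 * θ := by nlinarith [hθ.1]
        rw [Nat.cast_one, abs_of_nonneg h5] at h
        simp only [Nat.cast_one]
        linarith [hθ.1])
    simp_rw [mul_sub] at hl
    rw [intervalIntegral.integral_sub (hfc n) (hfc 1)] at hl
    refine tendsto_nhds_unique ?_ hl
    have h2 : Tendsto (fun r : ℝ => (c n * r ^ n - c 1 * r ^ 1) * (Real.pi / 2))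
        (nhdsWithin 1 (Iio 1)) (nhds ((c n - c 1) * (Real.pi / 2))) := by
      have : Continuous (fun r : ℝ => (c n * r ^ n - c 1 * r ^ 1) * (Real.pi / 2)) := by fun_prop
      have := (this.tendsto 1).mono_left (nhdsWithin_le_nhds (s := Iio 1))
      simpa using this
    refine h2.congr' ?_
    filter_upwards [hIoo] with r hr
    have huc : ∀ n : ℕ, IntervalIntegrable (fun θ => u r θ * Real.cos (n * θ)) volume 0 Real.pi :=
      fun n => Continuous.intervalIntegrable ((hc r hr).mul (by fun_prop)) _ _
    rw [intervalIntegral.integral_sub (huc n) (huc 1),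
      aux_fourier c (u r) r hr (habs r hr) (hsumu r hr) n hn,
      aux_fourier c (u r) r hr (habs r hr) (hsumu r hr) 1 le_rfl]
    ring
  have hconv : ∃ a, Tendsto c atTop (nhds a) := by
    have hRL := aux_RL f hint
    have h3 := ((hRL.sub_const
      (∫ θ in (0:ℝ)..Real.pi, f θ * Real.cos ((1:ℕ) * θ))).mul_const (2 / Real.pi)).const_add (c 1)
    refine ⟨_, h3.congr' ?_⟩
    filter_upwards [eventually_ge_atTop 1] with n hn
    rw [← key n hn]
    have := Real.pi_ne_zero
    field_simp
    ring
  obtain ⟨a, ha⟩ := hconv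
  exact ⟨a, ha, aux_abel c a (fun r => U r) hS ha⟩
end

section
/- Let F(z) = Σ_{n=0}^∞ c_n z^n be analytic on the open unit disc 𝔻 with real coefficients c_n, and set U(z) = Re F(z). Assume U has L¹_loc-boundary behavior on ∂𝔻∖{1}, and assume there exist θ₀ ∈ (0,π), g ∈ L¹(−θ₀,θ₀), k ∈ ℕ and C > 0 such that |U(re^{iθ})| ≤ C(1−r)^{−k} for all θ ∈ (−θ₀,θ₀) and r ∈ [0,1), and U(re^{iθ}) ≥ g(θ) for a.e. θ ∈ (−θ₀,θ₀) and all r ∈ [0,1). Then the sequence (c_n) converges, and its limit equals lim_{r→1⁻} (1−r) U(r). -/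
open MeasureTheory Filter Set

lemma cos_orth (m n : ℕ) : ∫ θ in (0:ℝ)..Real.pi, Real.cos (m * θ) * Real.cos (n * θ)
    = if m = n then (if n = 0 then Real.pi else Real.pi / 2) else 0 := by
  have h0 : ∀ a : ℤ, ∫ θ in (0:ℝ)..Real.pi, Real.cos (a * θ) = if a = 0 then Real.pi else 0 := by
    intro a
    split_ifs with h
    · simp [h]
    · rw [intervalIntegral.integral_comp_mul_left (fun x => Real.cos x) (by exact_mod_cast h)]
      simp [Real.sin_int_mul_pi]
  have h1 : ∀ θ : ℝ, Real.cos (m * θ) * Real.cos (n * θ)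
      = (1/2) * (Real.cos (((m:ℤ) - n : ℤ) * θ) + Real.cos (((m:ℤ) + n : ℤ) * θ)) := by
    intro θ
    push_cast
    rw [sub_mul, add_mul, Real.cos_sub, Real.cos_add]; ring
  simp_rw [h1]
  rw [intervalIntegral.integral_const_mul, intervalIntegral.integral_add
    (Continuous.intervalIntegrable (by fun_prop) _ _) (Continuous.intervalIntegrable (by fun_prop) _ _), h0, h0]
  split_ifs <;> first | omega | ring

lemma abel_part (c : ℕ → ℝ) (a : ℝ) (hc : Tendsto c atTop (nhds a)) (u : ℝ → ℝ)
    (hu : ∀ r ∈ Ico (0:ℝ) 1, HasSum (fun n => c n * r ^ n) (u r)) :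
    Tendsto (fun r => (1 - r) * u r) (nhdsWithin 1 (Iio 1)) (nhds a) := by
  let d : ℕ → ℝ := fun n => Nat.casesOn n (c 0) (fun k => c (k+1) - c k)
  have hd : ∀ n, ∑ i ∈ Finset.range (n+1), d i = c n := by
    intro n
    induction n with
    | zero => simp [d]
    | succ k ih => rw [Finset.sum_range_succ, ih]; simp [d]
  have h1 : Tendsto (fun n => ∑ i ∈ Finset.range n, d i) atTop (nhds a) := by
    rw [← tendsto_add_atTop_iff_nat 1]
    simpa [hd] using hc
  refine (Real.tendsto_tsum_powerSeries_nhdsWithin_lt h1).congr' ?_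
  filter_upwards [Ioo_mem_nhdsLT (show (0:ℝ) < 1 by norm_num)] with r hr
  have hs := hu r ⟨hr.1.le, hr.2⟩
  have hs1 : HasSum (fun n => c (n+1) * r ^ (n+1)) (u r - c 0) := by
    have := (hasSum_nat_add_iff' 1).2 hs
    simpa using this
  have h2 : HasSum (fun n => d (n+1) * r ^ (n+1)) (u r - c 0 - r * u r) := by
    have := hs1.sub (hs.mul_left r)
    refine this.congr_fun ?_ |> id
    intro n; simp only [d]; ring
  have h3 : HasSum (fun n => d n * r ^ n) (u r - r * u r) := by
    have := (hasSum_nat_add_iff (f := fun n => d n * r ^ n) 1).1 h2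
    have e : u r - c 0 - r * u r + ∑ i ∈ Finset.range 1, d i * r ^ i = u r - r * u r := by
      simp [d]; ring
    rwa [e] at this
  rw [h3.tsum_eq]; ring

lemma RL (f : ℝ → ℝ) (hf : IntegrableOn f (Ioc 0 Real.pi)) :
    Tendsto (fun n : ℕ => ∫ θ in (0:ℝ)..Real.pi, f θ * Real.cos (n * θ)) atTop (nhds 0) := by
  let G : ℝ → ℂ := (Ioc 0 Real.pi).indicator (fun x => (f x : ℂ))
  have hG : Integrable G := by
    rw [integrable_indicator_iff measurableSet_Ioc]
    exact hf.ofReal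
  have h := Real.tendsto_integral_exp_smul_cocompact G
  have hn : Tendsto (fun n : ℕ => (n:ℝ) / (2 * Real.pi)) atTop (cocompact ℝ) := by
    refine Tendsto.mono_right ?_ atTop_le_cocompact
    exact tendsto_natCast_atTop_atTop.atTop_div_const (by positivity)
  have h2 := (Complex.continuous_re.tendsto _).comp (h.comp hn)
  refine h2.congr ?_
  intro n
  simp only [Function.comp]
  have hint : Integrable (fun v : ℝ => Real.fourierChar (-(v * (n / (2 * Real.pi)))) • G v) := by
    have := (Real.fourierIntegral_convergent_iff (f := G) (μ := volume) (n / (2 * Real.pi) : ℝ)).2 hG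
    refine this.congr (ae_of_all _ fun v => ?_)
    simp [mul_comm]
  rw [← RCLike.re_eq_complex_re, ← integral_re hint, intervalIntegral.integral_of_le Real.pi_pos.le,
    ← integral_indicator measurableSet_Ioc]
  congr 1
  ext v
  by_cases hv : v ∈ Ioc 0 Real.pi
  · simp only [G, indicator_of_mem hv, Circle.smul_def, Real.fourierChar_apply, smul_eq_mul]
    have : (((2 * Real.pi * (-(v * (n / (2 * Real.pi)))) : ℝ) : ℂ)) * Complex.I = ((-(n * v) : ℝ) : ℂ) * Complex.I := by
      congr 2; field_simp
    rw [this, Complex.exp_mul_I]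
    simp only [RCLike.re_eq_complex_re, Complex.re_mul_ofReal, Complex.add_re, ← Complex.ofReal_cos, ← Complex.ofReal_sin, Complex.ofReal_re, Complex.re_ofReal_mul, Complex.I_re]
    simp [mul_comm]
  · simp [G, indicator_of_notMem hv]

lemma core (u : ℝ → ℝ → ℝ) (hcont : ∀ r ∈ Ico (0:ℝ) 1, Continuous (u r))
    (f : ℝ → ℝ) (hf : ∀ δ ∈ Ioo 0 Real.pi, IntegrableOn f (Icc δ Real.pi) ∧
      Tendsto (fun r => ∫ θ in δ..Real.pi, |u r θ - f θ|) (nhdsWithin 1 (Iio 1)) (nhds 0))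
    (B : ℝ) (hB : ∀ r ∈ Ico (0:ℝ) 1, ∫ θ in (0:ℝ)..Real.pi, u r θ = B)
    (t : ℝ) (ht : t ∈ Ioo 0 Real.pi) (g : ℝ → ℝ) (hg : IntegrableOn g (Ioc 0 t))
    (hlow : ∀ r ∈ Ico (0:ℝ) 1, ∀ᵐ θ ∂(volume.restrict (Ioc 0 t)), g θ ≤ u r θ) :
    IntegrableOn f (Ioc 0 Real.pi) ∧ ∀ φ : ℝ → ℝ, Continuous φ → (∀ x, |φ x - φ 0| ≤ 2) →
      Tendsto (fun r => ∫ θ in (0:ℝ)..Real.pi, u r θ * φ θ) (nhdsWithin 1 (Iio 1))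
        (nhds ((∫ θ in (0:ℝ)..Real.pi, f θ * φ θ) + (B - ∫ θ in (0:ℝ)..Real.pi, f θ) * φ 0)) := by
  have hev : ∀ᶠ r in nhdsWithin (1:ℝ) (Iio 1), r ∈ Ico (0:ℝ) 1 :=
    mem_of_superset (Ioo_mem_nhdsLT (show (0:ℝ) < 1 by norm_num)) Ioo_subset_Ico_self
  have hfi : ∀ δ ∈ Ioo 0 Real.pi, IntervalIntegrable f volume δ Real.pi := fun δ hδ =>
    (intervalIntegrable_iff_integrableOn_Icc_of_le hδ.2.le).2 (hf δ hδ).1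
  have hui : ∀ r ∈ Ico (0:ℝ) 1, ∀ a b, IntervalIntegrable (u r) volume a b :=
    fun r hr a b => (hcont r hr).intervalIntegrable a b
  have hgi : IntervalIntegrable g volume 0 t :=
    (intervalIntegrable_iff_integrableOn_Ioc_of_le ht.1.le).2 hg
  -- uniform bound
  obtain ⟨M, hM⟩ : ∃ M, ∀ᶠ r in nhdsWithin (1:ℝ) (Iio 1), ∫ θ in (0:ℝ)..Real.pi, |u r θ| ≤ M := by
    refine ⟨B + 2 * (∫ θ in (0:ℝ)..t, |g θ|) + 2 * ((∫ θ in t..Real.pi, |f θ|) + 1), ?_⟩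
    filter_upwards [hev, (hf t ht).2.eventually (gt_mem_nhds one_pos)] with r hr h1
    have e1 := intervalIntegral.integral_add_adjacent_intervals (hui r hr 0 t) (hui r hr t Real.pi)
    have e2 := intervalIntegral.integral_add_adjacent_intervals (hui r hr 0 t).abs (hui r hr t Real.pi).abs
    have e3 : ∫ θ in t..Real.pi, |u r θ| ≤ (∫ θ in t..Real.pi, |f θ|) + ∫ θ in t..Real.pi, |u r θ - f θ| := by
      rw [← intervalIntegral.integral_add (hfi t ht).abs ((hui r hr _ _).sub (hfi t ht)).abs]
      refine intervalIntegral.integral_mono_on ht.2.le (hui r hr _ _).abs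
        ((hfi t ht).abs.add ((hui r hr _ _).sub (hfi t ht)).abs) ?_
      intro x _
      have := abs_add_le (f x) (u r x - f x)
      simpa using this
    have e4 : ∫ θ in (0:ℝ)..t, |u r θ| ≤ (∫ θ in (0:ℝ)..t, u r θ) + 2 * ∫ θ in (0:ℝ)..t, |g θ| := by
      rw [← intervalIntegral.integral_const_mul, ← intervalIntegral.integral_add (hui r hr _ _) (hgi.abs.const_mul 2)]
      rw [intervalIntegral.integral_of_le ht.1.le, intervalIntegral.integral_of_le ht.1.le]
      refine integral_mono_ae (hui r hr 0 t).abs.1 ((hui r hr _ _).add (hgi.abs.const_mul 2)).1 ?_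
      filter_upwards [hlow r hr] with x hx
      have := neg_abs_le (g x)
      have := abs_nonneg (g x)
      exact abs_le.2 ⟨by linarith, by linarith⟩
    have e5 : |∫ θ in t..Real.pi, u r θ| ≤ ∫ θ in t..Real.pi, |u r θ| :=
      intervalIntegral.abs_integral_le_integral_abs ht.2.le
    have e6 := (abs_le.1 e5).1
    have e7 := hB r hr
    linarith
  have hnb : (nhdsWithin (1:ℝ) (Iio 1)).NeBot := inferInstance
  have hfb : ∀ δ ∈ Ioo 0 Real.pi, ∫ θ in δ..Real.pi, |f θ| ≤ M := by
    intro δ hδ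
    have hl : Tendsto (fun r => M + ∫ θ in δ..Real.pi, |u r θ - f θ|) (nhdsWithin 1 (Iio 1)) (nhds (M + 0)) :=
      (hf δ hδ).2.const_add M
    rw [add_zero] at hl
    refine ge_of_tendsto hl ?_
    filter_upwards [hev, hM] with r hr h1
    have e2 := intervalIntegral.integral_add_adjacent_intervals (hui r hr 0 δ).abs (hui r hr δ Real.pi).abs
    have e0 : 0 ≤ ∫ θ in (0:ℝ)..δ, |u r θ| :=
      intervalIntegral.integral_nonneg hδ.1.le fun x _ => abs_nonneg _
    have e3 : ∫ θ in δ..Real.pi, |f θ| ≤ (∫ θ in δ..Real.pi, |u r θ|) + ∫ θ in δ..Real.pi, |u r θ - f θ| := by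
      rw [← intervalIntegral.integral_add (hui r hr _ _).abs ((hui r hr _ _).sub (hfi δ hδ)).abs]
      refine intervalIntegral.integral_mono_on hδ.2.le (hfi δ hδ).abs
        ((hui r hr _ _).abs.add ((hui r hr _ _).sub (hfi δ hδ)).abs) ?_
      intro x _
      have := abs_sub (u r x) (u r x - f x)
      simpa using this
    linarith
  have hfI : IntegrableOn f (Ioc 0 Real.pi) := by
    have hp := Real.pi_pos
    have ha : ∀ n : ℕ, Real.pi / (n + 2) ∈ Ioo 0 Real.pi := fun n =>
      ⟨by positivity, div_lt_self hp (by have : (0:ℝ) ≤ n := n.cast_nonneg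
                                         linarith)⟩
    refine integrableOn_Ioc_of_intervalIntegral_norm_bounded_left (l := atTop) (I := M)
      (a := fun n : ℕ => Real.pi / (n + 2)) (fun n => (hfi _ (ha n)).1) ?_ ?_
    · exact tendsto_const_nhds.div_atTop (tendsto_atTop_add_const_right _ _ tendsto_natCast_atTop_atTop)
    · refine Eventually.of_forall fun n => ?_
      have := hfb _ (ha n)
      rwa [intervalIntegral.integral_of_le (ha n).2.le] at this
  refine ⟨hfI, fun φ hφ hφ2 => ?_⟩
  have hf0 : IntervalIntegrable f volume 0 Real.pi :=
    (intervalIntegrable_iff_integrableOn_Ioc_of_le Real.pi_pos.le).2 hfI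
  have hV : ∀ r ∈ Ico (0:ℝ) 1, IntervalIntegrable (fun θ => u r θ - f θ) volume 0 Real.pi :=
    fun r hr => (hui r hr _ _).sub hf0
  let K := M + ∫ θ in (0:ℝ)..Real.pi, |f θ|
  have hK : ∀ᶠ r in nhdsWithin (1:ℝ) (Iio 1), ∫ θ in (0:ℝ)..Real.pi, |u r θ - f θ| ≤ K := by
    filter_upwards [hev, hM] with r hr h1
    have : ∫ θ in (0:ℝ)..Real.pi, |u r θ - f θ| ≤ (∫ θ in (0:ℝ)..Real.pi, |u r θ|) + ∫ θ in (0:ℝ)..Real.pi, |f θ| := by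
      rw [← intervalIntegral.integral_add (hui r hr _ _).abs hf0.abs]
      exact intervalIntegral.integral_mono_on Real.pi_pos.le (hV r hr).abs
        ((hui r hr _ _).abs.add hf0.abs) fun x _ => abs_sub _ _
    simp only [K]; linarith
  have key : Tendsto (fun r => ∫ θ in (0:ℝ)..Real.pi, (u r θ - f θ) * (φ θ - φ 0))
      (nhdsWithin 1 (Iio 1)) (nhds 0) := by
    rw [Metric.tendsto_nhds]
    intro ε hε
    have hK0 : 0 ≤ |K| := abs_nonneg K
    let η := ε / (2 * (|K| + 1))
    have hη : 0 < η := by positivity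
    obtain ⟨δ', hδ', hφδ⟩ := Metric.continuous_iff.1 hφ 0 η hη
    let δ := min (δ'/2) (Real.pi/2)
    have hδ : δ ∈ Ioo 0 Real.pi := ⟨by have := Real.pi_pos
                                       positivity,
      (min_le_right _ _).trans_lt (by linarith [Real.pi_pos])⟩
    have hδl : δ < δ' := (min_le_left _ _).trans_lt (by linarith)
    filter_upwards [hev, hK, (hf δ hδ).2.eventually (gt_mem_nhds (show (0:ℝ) < ε/4 by positivity))] with r hr h1 h2
    have hV1 : IntervalIntegrable (fun θ => u r θ - f θ) volume 0 δ :=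
      (hV r hr).mono_set (by rw [uIcc_of_le hδ.1.le, uIcc_of_le Real.pi_pos.le]; exact Icc_subset_Icc_right hδ.2.le)
    have hV2 : IntervalIntegrable (fun θ => u r θ - f θ) volume δ Real.pi :=
      (hui r hr _ _).sub (hfi δ hδ)
    have hc : Continuous (fun θ => φ θ - φ 0) := by fun_prop
    have hW1 := hV1.mul_continuousOn hc.continuousOn
    have hW2 := hV2.mul_continuousOn hc.continuousOn
    have e1 := intervalIntegral.integral_add_adjacent_intervals hW1 hW2
    have e2 := intervalIntegral.integral_add_adjacent_intervals hV1.abs hV2.abs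
    have e3 : |∫ θ in (0:ℝ)..δ, (u r θ - f θ) * (φ θ - φ 0)| ≤ η * ∫ θ in (0:ℝ)..δ, |u r θ - f θ| := by
      refine (intervalIntegral.abs_integral_le_integral_abs hδ.1.le).trans ?_
      rw [← intervalIntegral.integral_const_mul]
      refine intervalIntegral.integral_mono_on hδ.1.le hW1.abs (hV1.abs.const_mul η) fun x hx => ?_
      rw [abs_mul, mul_comm]
      have := (hφδ x (by rw [Real.dist_eq, sub_zero, abs_of_nonneg hx.1]; exact hx.2.trans_lt hδl)).le
      rw [Real.dist_eq] at this
      gcongr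
    have e4 : |∫ θ in δ..Real.pi, (u r θ - f θ) * (φ θ - φ 0)| ≤ 2 * ∫ θ in δ..Real.pi, |u r θ - f θ| := by
      refine (intervalIntegral.abs_integral_le_integral_abs hδ.2.le).trans ?_
      rw [← intervalIntegral.integral_const_mul]
      refine intervalIntegral.integral_mono_on hδ.2.le hW2.abs (hV2.abs.const_mul 2) fun x hx => ?_
      rw [abs_mul, mul_comm]
      have := hφ2 x
      gcongr
    have e5 : 0 ≤ ∫ θ in δ..Real.pi, |u r θ - f θ| :=
      intervalIntegral.integral_nonneg hδ.2.le fun x _ => abs_nonneg _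
    have e6 : η * ∫ θ in (0:ℝ)..δ, |u r θ - f θ| ≤ η * (|K| + 1) := by
      gcongr
      have := le_abs_self K
      linarith
    have e7 : η * (|K| + 1) = ε / 2 := by simp only [η]; field_simp
    rw [Real.dist_eq, sub_zero, ← e1]
    have := abs_add_le (∫ θ in (0:ℝ)..δ, (u r θ - f θ) * (φ θ - φ 0)) (∫ θ in δ..Real.pi, (u r θ - f θ) * (φ θ - φ 0))
    linarith
  have := key.add_const ((∫ θ in (0:ℝ)..Real.pi, f θ * φ θ) + (B - ∫ θ in (0:ℝ)..Real.pi, f θ) * φ 0)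
  rw [zero_add] at this
  refine this.congr' ?_
  filter_upwards [hev] with r hr
  have i1 := (hui r hr 0 Real.pi).mul_continuousOn hφ.continuousOn
  have i2 := hf0.mul_continuousOn hφ.continuousOn
  have : ∫ θ in (0:ℝ)..Real.pi, (u r θ - f θ) * (φ θ - φ 0) =
      ∫ θ in (0:ℝ)..Real.pi, ((u r θ * φ θ - f θ * φ θ) - (u r θ - f θ) * φ 0) := by
    congr 1; ext x; ring
  rw [this, intervalIntegral.integral_sub (i1.sub i2) ((hV r hr).mul_const _),
    intervalIntegral.integral_sub i1 i2, intervalIntegral.integral_mul_const,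
    intervalIntegral.integral_sub (hui r hr _ _) hf0, hB r hr]
  ring

/-- Theorem 1.4: Tauberian theorem for power series with real coefficients. -/
theorem power_series_tauberian_b3 (c : ℕ → ℝ) (F : ℂ → ℂ)
    (hF : ∀ z : ℂ, ‖z‖ < 1 → HasSum (fun n : ℕ => (c n : ℂ) * z ^ n) (F z))
    (U : ℂ → ℝ) (hU : ∀ z : ℂ, U z = (F z).re)
    (hbd : L1locBoundaryBehaviorDisc U)
    (θ₀ : ℝ) (hθ₀ : θ₀ ∈ Ioo 0 Real.pi)
    (g : ℝ → ℝ) (hg : IntegrableOn g (Ioo (-θ₀) θ₀))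
    (k : ℕ) (C : ℝ) (hC : 0 < C)
    (hgrow : ∀ θ ∈ Ioo (-θ₀) θ₀, ∀ r ∈ Ico (0 : ℝ) 1,
      |U (r * Complex.exp (θ * Complex.I))| ≤ C / (1 - r) ^ k)
    (hlow : ∀ r ∈ Ico (0 : ℝ) 1, ∀ᵐ θ ∂(volume.restrict (Ioo (-θ₀) θ₀)),
      g θ ≤ U (r * Complex.exp (θ * Complex.I))) :
    ∃ a : ℝ,
      Tendsto c atTop (nhds a) ∧
      Tendsto (fun r : ℝ => (1 - r) * U r) (nhdsWithin 1 (Iio 1)) (nhds a) := by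
  have hur : ∀ r ∈ Ico (0:ℝ) 1, HasSum (fun n => c n * r ^ n) (U r) := by
    intro r hr
    have h := Complex.hasSum_re (hF r (by simpa [abs_of_nonneg hr.1] using hr.2))
    rw [hU]
    refine h.congr_fun ?_ |> id
    intro n
    rw [← Complex.ofReal_pow, ← Complex.ofReal_mul, Complex.ofReal_re]
  have hsum : ∀ r ∈ Ico (0:ℝ) 1, Summable (fun n => |c n| * r ^ n) := by
    intro r hr
    refine (hur r hr).summable.abs.congr fun n => ?_
    rw [abs_mul, abs_of_nonneg (pow_nonneg hr.1 n)]
  have hcos : ∀ r ∈ Ico (0:ℝ) 1, ∀ θ : ℝ,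
      HasSum (fun n : ℕ => c n * r ^ n * Real.cos (n * θ)) (U (r * Complex.exp (θ * Complex.I))) := by
    intro r hr θ
    have h := Complex.hasSum_re (hF (r * Complex.exp (θ * Complex.I))
      (by rw [norm_mul, Complex.norm_exp_ofReal_mul_I]; simpa [abs_of_nonneg hr.1] using hr.2))
    rw [hU]
    refine h.congr_fun ?_ |> id
    intro n
    rw [mul_pow, ← Complex.exp_nat_mul, ← mul_assoc, ← mul_assoc, ← Complex.ofReal_pow, ← Complex.ofReal_mul,
      Complex.re_ofReal_mul, ← Complex.ofReal_natCast, ← Complex.ofReal_mul, Complex.exp_ofReal_mul_I_re]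
  have hbound : ∀ r ∈ Ico (0:ℝ) 1, ∀ (n : ℕ) (x : ℝ), |x| ≤ 1 → ‖c n * r ^ n * x‖ ≤ |c n| * r ^ n := by
    intro r hr n x hx
    rw [Real.norm_eq_abs, abs_mul, abs_mul, abs_of_nonneg (pow_nonneg hr.1 n)]
    exact mul_le_of_le_one_right (mul_nonneg (abs_nonneg _) (pow_nonneg hr.1 n)) hx
  have hcont : ∀ r ∈ Ico (0:ℝ) 1, Continuous (fun θ : ℝ => U (r * Complex.exp (θ * Complex.I))) := by
    intro r hr
    have := continuous_tsum (f := fun (n : ℕ) (θ : ℝ) => c n * r ^ n * Real.cos (n * θ))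
      (fun n => by fun_prop) (hsum r hr) (fun n θ => hbound r hr n _ (Real.abs_cos_le_one _))
    refine this.congr fun θ => (hcos r hr θ).tsum_eq
  have hcoef : ∀ r ∈ Ico (0:ℝ) 1, ∀ n : ℕ,
      ∫ θ in (0:ℝ)..Real.pi, U (r * Complex.exp (θ * Complex.I)) * Real.cos (n * θ)
        = c n * r ^ n * (if n = 0 then Real.pi else Real.pi / 2) := by
    intro r hr n
    have h := intervalIntegral.hasSum_integral_of_dominated_convergence (μ := volume) (a := 0) (b := Real.pi)
      (F := fun (m : ℕ) (θ : ℝ) => c m * r ^ m * (Real.cos (m * θ) * Real.cos (n * θ)))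
      (f := fun θ : ℝ => U (r * Complex.exp (θ * Complex.I)) * Real.cos (n * θ))
      (fun m _ => |c m| * r ^ m)
      (fun m => (Continuous.aestronglyMeasurable (by fun_prop)))
      (fun m => ae_of_all _ fun θ _ => hbound r hr m _ (by
        rw [abs_mul]
        exact mul_le_one₀ (Real.abs_cos_le_one _) (abs_nonneg _) (Real.abs_cos_le_one _)))
      (ae_of_all _ fun θ _ => hsum r hr)
      (by simp)
      (ae_of_all _ fun θ _ => by
        simpa [mul_assoc] using (hcos r hr θ).mul_right (Real.cos (n * θ)))
    simp_rw [intervalIntegral.integral_const_mul, cos_orth] at h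
    refine h.unique ?_
    have h2 := hasSum_ite_eq n (c n * r ^ n * (if n = 0 then Real.pi else Real.pi / 2))
    refine h2.congr_fun ?_ |> id
    intro m
    by_cases hm : m = n
    · subst hm; simp
    · simp [hm]
  obtain ⟨f, hf⟩ := hbd
  have hp := Real.pi_pos
  have ht : θ₀ / 2 ∈ Ioo 0 Real.pi := ⟨by linarith [hθ₀.1], by linarith [hθ₀.1, hθ₀.2]⟩
  have hsub : Ioc 0 (θ₀ / 2) ⊆ Ioo (-θ₀) θ₀ := fun x hx =>
    ⟨by linarith [hx.1, hθ₀.1], by linarith [hx.2, hθ₀.1]⟩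
  obtain ⟨hfI, hlim⟩ := core (fun r θ => U (r * Complex.exp (θ * Complex.I))) hcont f
    (fun δ hδ => hf δ Real.pi (by linarith [hδ.1]) hδ.2.le le_rfl (fun h => absurd h.1 (not_le.2 hδ.1)))
    (c 0 * Real.pi) (fun r hr => by simpa using hcoef r hr 0)
    (θ₀ / 2) ht g (hg.mono_set hsub)
    (fun r hr => ae_restrict_of_ae_restrict_of_subset hsub (hlow r hr))
  set A := c 0 * Real.pi - ∫ θ in (0:ℝ)..Real.pi, f θ with hA
  have hc : ∀ n : ℕ, n ≠ 0 → c n = ((∫ θ in (0:ℝ)..Real.pi, f θ * Real.cos (n * θ)) + A) / (Real.pi / 2) := by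
    intro n hn
    have h1 := hlim (fun θ => Real.cos (n * θ)) (by fun_prop) (fun x => by
      have h3 := Real.cos_le_one (n * x)
      have h4 := Real.neg_one_le_cos (n * x)
      simp only [mul_zero, Real.cos_zero]
      exact abs_le.2 ⟨by linarith, by linarith⟩)
    have h2 : Tendsto (fun r : ℝ => c n * r ^ n * (Real.pi / 2)) (nhdsWithin 1 (Iio 1))
        (nhds (c n * 1 ^ n * (Real.pi / 2))) :=
      ((by fun_prop : Continuous (fun r : ℝ => c n * r ^ n * (Real.pi / 2))).tendsto 1).mono_left nhdsWithin_le_nhds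
    have h5 := tendsto_nhds_unique (h2.congr' ?_) h1
    · rw [eq_div_iff (by positivity)]
      simpa using h5
    · filter_upwards [Ioo_mem_nhdsLT (show (0:ℝ) < 1 by norm_num)] with r hr
      have := hcoef r ⟨hr.1.le, hr.2⟩ n
      rw [if_neg hn] at this
      exact this.symm
  have hlimc : Tendsto c atTop (nhds ((0 + A) / (Real.pi / 2))) := by
    refine (((RL f hfI).add_const A).div_const (Real.pi / 2)).congr' ?_
    filter_upwards [eventually_ne_atTop 0] with n hn
    exact (hc n hn).symm
  exact ⟨_, hlimc, abel_part c _ hlimc (fun r => U r) hur⟩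
end

section
/- (Blackwell's renewal theorem.) Let dP be a Borel probability measure on [0,∞) with dP({0}) = 0 which is non-lattice, i.e. there is no α > 0 such that dP is concentrated on {α, 2α, 3α, ...}. Let dQ = Σ_{n=0}^∞ dP^{*n} be the renewal measure (where dP^{*0} = δ₀ is the Dirac measure at 0 and * is convolution of measures on [0,∞)), and set Q(x) = dQ([0,x]). Then for every h > 0, Q(x+h) − Q(x) → h / ∫₀^∞ x dP(x) as x → ∞, where the limit is interpreted as 0 when the mean ∫₀^∞ x dP(x) is infinite. -/
open MeasureTheory Filter Set

/-- Convolution of two Borel measures on `ℝ` (pushforward of the product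
measure under addition). -/
noncomputable def convMeas (P Q : Measure ℝ) : Measure ℝ :=
  (P.prod Q).map (fun p : ℝ × ℝ => p.1 + p.2)

/-- `n`-fold convolution power `P^{*n}` with `P^{*0} = δ₀`. -/
noncomputable def convPow (P : Measure ℝ) : ℕ → Measure ℝ
  | 0 => Measure.dirac 0
  | n + 1 => convMeas (convPow P n) P

open Topology in
theorem bw_semigroup (P : Measure ℝ) [IsProbabilityMeasure P]
    (hpos : ∀ᵐ x ∂P, 0 < x)
    (hnonlattice : ¬ ∃ α : ℝ, 0 < α ∧
      P {x : ℝ | ∃ n : ℕ, 1 ≤ n ∧ x = α * n} = 1) (ε : ℝ) (hε : 0 < ε) :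
    ∃ Y : ℝ, ∀ y ≥ Y, ∃ a ∈ AddSubmonoid.closure P.support, |y - a| < ε := by
  have hS : ∀ᵐ x ∂P, x ∈ P.support := Measure.support_mem_ae
  have hS0 : P.support ⊆ Ici 0 := by
    apply Measure.support_subset_of_isClosed isClosed_Ici
    filter_upwards [hpos] with x hx using hx.le
  obtain ⟨s, hs, hspos⟩ := (hS.and hpos).exists
  have hdense : Dense (AddSubgroup.closure P.support : Set ℝ) := by
    rcases AddSubgroup.dense_or_cyclic (AddSubgroup.closure P.support) with h | ⟨a, ha⟩
    · exact h
    · exfalso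
      have key : ∀ x ∈ P.support, ∃ n : ℤ, x = n * a := by
        intro x hx
        have : x ∈ AddSubgroup.closure P.support := AddSubgroup.subset_closure hx
        rw [ha, AddSubgroup.mem_closure_singleton] at this
        obtain ⟨n, hn⟩ := this
        exact ⟨n, by rw [← hn]; simp⟩
      apply hnonlattice
      have ha0 : a ≠ 0 := by
        rintro rfl
        obtain ⟨n, hn⟩ := key s hs
        simp at hn
        linarith
      refine ⟨|a|, abs_pos.2 ha0, ?_⟩
      rw [← measure_univ (μ := P)]
      apply measure_congr
      rw [eventuallyEq_univ]
      filter_upwards [hS, hpos] with x hx hx0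
      obtain ⟨n, hn⟩ := key x hx
      refine ⟨n.natAbs, ?_, ?_⟩
      · rw [Nat.one_le_iff_ne_zero, Int.natAbs_ne_zero]
        rintro rfl
        simp at hn
        linarith
      · rw [Nat.cast_natAbs, Int.cast_abs, mul_comm, ← abs_mul, ← hn, abs_of_pos hx0]
  have hdiff : ∀ x ∈ AddSubgroup.closure P.support, ∃ a ∈ AddSubmonoid.closure P.support,
      ∃ b ∈ AddSubmonoid.closure P.support, x = b - a := by
    intro x hx
    induction hx using AddSubgroup.closure_induction with
    | mem x hx => exact ⟨0, zero_mem _, x, AddSubmonoid.subset_closure hx, by simp⟩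
    | zero => exact ⟨0, zero_mem _, 0, zero_mem _, by simp⟩
    | add x y _ _ hx hy =>
      obtain ⟨a, ha, b, hb, rfl⟩ := hx
      obtain ⟨c, hc, d, hd, rfl⟩ := hy
      exact ⟨a + c, add_mem ha hc, b + d, add_mem hb hd, by ring⟩
    | neg x _ hx =>
      obtain ⟨a, ha, b, hb, rfl⟩ := hx
      exact ⟨b, hb, a, ha, by ring⟩
  have hnn : ∀ x ∈ AddSubmonoid.closure P.support, 0 ≤ x := by
    intro x hx
    induction hx using AddSubmonoid.closure_induction with
    | mem x hx => exact hS0 hx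
    | zero => exact le_rfl
    | add x y _ _ hx hy => exact add_nonneg hx hy
  obtain ⟨x, hx, hx'⟩ := hdense.exists_mem_open (isOpen_Ioo (a := (0:ℝ)) (b := ε)) ⟨ε/2, by constructor <;> linarith⟩
  obtain ⟨a', ha', b', hb', hxab⟩ := hdiff x hx
  obtain ⟨a, ha, b, hb, ha0, hd0, hdε⟩ : ∃ a ∈ AddSubmonoid.closure P.support,
      ∃ b ∈ AddSubmonoid.closure P.support, 0 < a ∧ 0 < b - a ∧ b - a < ε := by
    have hs' := AddSubmonoid.subset_closure hs
    refine ⟨a' + s, add_mem ha' hs', b' + s, add_mem hb' hs', ?_, ?_, ?_⟩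
    · have := hnn a' ha'; linarith
    · have := hx'.1; linarith
    · have := hx'.2; linarith
  set δ := b - a with hδ
  refine ⟨(⌈a/δ⌉₊ : ℝ) * a, fun y hy => ?_⟩
  have hy0 : 0 ≤ y := le_trans (by positivity) hy
  set q := ⌊y/a⌋₊ with hq
  have hq1 : (q:ℝ) ≤ y / a := Nat.floor_le (by positivity)
  have hq2 : y / a < q + 1 := Nat.lt_floor_add_one _
  rw [le_div_iff₀ ha0] at hq1
  rw [div_lt_iff₀ ha0] at hq2
  have hqn : ⌈a/δ⌉₊ ≤ q := by
    apply Nat.le_floor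
    rwa [le_div_iff₀ ha0]
  set k := ⌊(y - q * a)/δ⌋₊ with hk
  have hr0 : 0 ≤ y - q * a := by linarith
  have hk1 : (k:ℝ) ≤ (y - q * a)/δ := Nat.floor_le (by positivity)
  have hk2 : (y - q * a)/δ < k + 1 := Nat.lt_floor_add_one _
  have hkq : k ≤ q := by
    refine le_trans ?_ hqn
    have h1 : (k:ℝ) ≤ a / δ := hk1.trans (by gcongr; linarith)
    exact_mod_cast h1.trans (Nat.le_ceil _)
  rw [le_div_iff₀ hd0] at hk1
  rw [div_lt_iff₀ hd0] at hk2
  refine ⟨(q - k) • a + k • b, add_mem (nsmul_mem ha _) (nsmul_mem hb _), ?_⟩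
  rw [nsmul_eq_mul, nsmul_eq_mul, Nat.cast_sub hkq, abs_lt]
  constructor <;> nlinarith

theorem bw_maxprinciple (P : Measure ℝ) [IsProbabilityMeasure P]
    (hpos : ∀ᵐ x ∂P, 0 < x)
    (hnonlattice : ¬ ∃ α : ℝ, 0 < α ∧
      P {x : ℝ | ∃ n : ℕ, 1 ≤ n ∧ x = α * n} = 1)
    (ζ : ℝ → ℝ) (K C : ℝ) (hK : ∀ x y, |ζ x - ζ y| ≤ K * |x - y|)
    (hcont : Continuous ζ) (hC : ∀ x, |ζ x| ≤ C)
    (hharm : ∀ x, ζ x = ∫ u, ζ (x - u) ∂P) (hmax : ∀ x, ζ x ≤ ζ 0) (ε : ℝ) (hε : 0 < ε) :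
    ∃ Y : ℝ, ∀ y ≥ Y, ζ 0 - ε ≤ ζ (-y) := by
  have hK0 : 0 ≤ K := by
    have := (abs_nonneg _).trans (hK 1 0)
    simpa using this
  have hzetaInt : ∀ x, Integrable (fun u => ζ (x - u)) P := by
    intro x
    refine Integrable.of_bound (by fun_prop) C ?_
    exact Eventually.of_forall fun u => hC _
  have step : ∀ x, ζ x = ζ 0 → ∀ s ∈ P.support, ζ (x - s) = ζ 0 := by
    intro x hx
    have h1 : ∫ u, (ζ 0 - ζ (x - u)) ∂P = 0 := by
      rw [integral_sub (integrable_const _) (hzetaInt x), ← hharm x, hx]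
      simp
    rw [integral_eq_zero_iff_of_nonneg (fun u => sub_nonneg.2 (hmax _))
      ((integrable_const _).sub (hzetaInt x))] at h1
    have : P.support ⊆ {s | ζ (x - s) = ζ 0} := by
      apply Measure.support_subset_of_isClosed
      · exact isClosed_eq (by fun_prop) (by fun_prop)
      · filter_upwards [h1] with u hu
        simp at hu
        linarith
    exact this
  have step2 : ∀ s ∈ AddSubmonoid.closure P.support, ∀ x, ζ x = ζ 0 → ζ (x - s) = ζ 0 := by
    intro s hs
    induction hs using AddSubmonoid.closure_induction with
    | mem s hs => exact fun x hx => step x hx s hs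
    | zero => intro x hx; simpa using hx
    | add s t _ _ hs ht =>
      intro x hx
      have := ht _ (hs x hx)
      rwa [sub_sub] at this
  obtain ⟨Y, hY⟩ := bw_semigroup P hpos hnonlattice (ε / (K + 1)) (by positivity)
  refine ⟨Y, fun y hy => ?_⟩
  obtain ⟨a, ha, hya⟩ := hY y hy
  have h1 := step2 a ha 0 rfl
  have h2 := hK (-y) (0 - a)
  rw [h1] at h2
  have h3 : |-y - (0 - a)| = |y - a| := by rw [← abs_neg]; congr 1; ring
  rw [h3] at h2
  rw [lt_div_iff₀ (by positivity)] at hya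
  have := (abs_le.1 h2).1
  nlinarith [abs_nonneg (y - a)]

open Topology in
theorem bw_extract (w : ℕ → ℝ → ℝ) (K C : ℝ) (hK : ∀ n x y, |w n x - w n y| ≤ K * |x - y|)
    (hC : ∀ n x, |w n x| ≤ C) :
    ∃ ζ : ℝ → ℝ, ∃ φ : ℕ → ℕ, StrictMono φ ∧ ∀ x, Tendsto (fun n => w (φ n) x) atTop (𝓝 (ζ x)) := by
  have hK0 : 0 ≤ K := by
    have := (abs_nonneg _).trans (hK 0 1 0)
    simpa using this
  have hcomp : IsCompact (Set.univ.pi (fun _ : ℚ => Icc (-C) C)) :=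
    isCompact_univ_pi fun _ => isCompact_Icc
  obtain ⟨a, -, φ, hφ, hlim⟩ := hcomp.tendsto_subseq (x := fun n (q : ℚ) => w n q)
    (fun n q _ => abs_le.1 (hC n q))
  rw [tendsto_pi_nhds] at hlim
  have hex : ∀ x : ℝ, ∃ l, Tendsto (fun n => w (φ n) x) atTop (𝓝 l) := by
    intro x
    apply cauchySeq_tendsto_of_complete
    rw [Metric.cauchySeq_iff']
    intro ε hε
    obtain ⟨q, hq1, hq2⟩ := exists_rat_btwn (show x < x + ε / (4 * (K + 1)) by
      have : 0 < ε / (4 * (K+1)) := by positivity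
      linarith)
    have hc := (hlim q).cauchySeq
    rw [Metric.cauchySeq_iff'] at hc
    obtain ⟨N, hN⟩ := hc (ε / 4) (by positivity)
    refine ⟨N, fun n hn => ?_⟩
    have h1 := hN n hn
    simp only [Function.comp, Real.dist_eq] at h1 ⊢
    have hxq : |x - q| ≤ ε / (4 * (K + 1)) := by rw [abs_le]; constructor <;> linarith
    have hb : K * |x - q| ≤ ε / 4 := by
      rw [le_div_iff₀ (by positivity)] at hxq
      nlinarith [abs_nonneg (x - q)]
    have h2 := abs_le.1 ((hK (φ n) x q).trans hb)
    have h3 := abs_le.1 ((hK (φ N) x q).trans hb)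
    have h4 := abs_lt.1 h1
    rw [abs_lt]
    constructor <;> linarith [h2.1, h2.2, h3.1, h3.2, h4.1, h4.2]
  choose ζ hζ using hex
  exact ⟨ζ, φ, hφ, hζ⟩

open Topology in
theorem bw_diff_upper (P : Measure ℝ) [IsProbabilityMeasure P]
    (hpos : ∀ᵐ x ∂P, 0 < x)
    (hnonlattice : ¬ ∃ α : ℝ, 0 < α ∧
      P {x : ℝ | ∃ n : ℕ, 1 ≤ n ∧ x = α * n} = 1)
    (z g : ℝ → ℝ) (K C : ℝ) (hK : ∀ x y, |z x - z y| ≤ K * |x - y|)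
    (hC : ∀ x, |z x| ≤ C) (hg : Tendsto g atTop (𝓝 0))
    (hren : ∀ x, z x = g x + ∫ u, z (x - u) ∂P) (s ε : ℝ) (hε : 0 < ε) :
    ∀ᶠ x in atTop, z (x + s) - z x < ε := by
  have hzcont : Continuous z := by
    apply LipschitzWith.continuous (K := K.toNNReal)
    apply LipschitzWith.of_dist_le'
    simpa [Real.dist_eq] using hK
  by_contra hcon
  rw [not_eventually] at hcon
  set w : ℝ → ℝ := fun x => z (x + s) - z x with hw
  have hwC : ∀ x, |w x| ≤ 2 * C := fun x => by
    have h1 := abs_le.1 (hC (x + s)); have h2 := abs_le.1 (hC x)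
    rw [abs_le]; constructor <;> simp only [hw] <;> linarith [h1.1, h1.2, h2.1, h2.2]
  have hwK : ∀ x y, |w x - w y| ≤ 2 * K * |x - y| := fun x y => by
    have h1 := abs_le.1 (hK (x + s) (y + s)); have h2 := abs_le.1 (hK x y)
    rw [add_sub_add_right_eq_sub] at h1
    rw [abs_le]; constructor <;> simp only [hw] <;> linarith [h1.1, h1.2, h2.1, h2.2]
  have hbdd : atTop.IsBoundedUnder (· ≤ ·) w :=
    isBoundedUnder_of ⟨2 * C, fun x => (abs_le.1 (hwC x)).2⟩
  have hcob : atTop.IsCoboundedUnder (· ≤ ·) w :=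
    IsBoundedUnder.isCoboundedUnder_le (isBoundedUnder_of ⟨-(2 * C), fun x => (abs_le.1 (hwC x)).1⟩)
  set η := limsup w atTop with hη
  have hηε : ε ≤ η := by
    by_contra hlt
    push Not at hlt
    have := eventually_lt_of_limsup_lt hlt hbdd
    obtain ⟨x, h1, h2⟩ := (hcon.and_eventually this).exists
    exact h1 h2
  have hseq : ∀ n : ℕ, ∃ t : ℝ, (n : ℝ) ≤ t ∧ η - 1 / ((n : ℝ) + 1) < w t := by
    intro n
    have h1 : η - 1 / ((n : ℝ) + 1) < limsup w atTop := by
      have : (0:ℝ) < 1 / ((n : ℝ) + 1) := by positivity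
      linarith
    obtain ⟨t, h2, h3⟩ := ((frequently_lt_of_lt_limsup hcob h1).and_eventually
      (eventually_ge_atTop (n : ℝ))).exists
    exact ⟨t, h3, h2⟩
  choose t ht1 ht2 using hseq
  obtain ⟨ζ, φ, hφ, hlim⟩ := bw_extract (fun n x => w (t n + x)) (2 * K) (2 * C)
    (fun n x y => by simpa using hwK (t n + x) (t n + y)) (fun n x => hwC _)
  have htφ : Tendsto (fun n => t (φ n)) atTop atTop :=
    (tendsto_atTop_mono ht1 tendsto_natCast_atTop_atTop).comp hφ.tendsto_atTop
  have htx : ∀ x, Tendsto (fun n => t (φ n) + x) atTop atTop := fun x =>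
    tendsto_atTop_add_const_right _ _ htφ
  have hζC : ∀ x, |ζ x| ≤ 2 * C := fun x =>
    le_of_tendsto (hlim x).abs (Eventually.of_forall fun n => hwC _)
  have hζK : ∀ x y, |ζ x - ζ y| ≤ 2 * K * |x - y| := fun x y =>
    le_of_tendsto ((hlim x).sub (hlim y)).abs
      (Eventually.of_forall fun n => by simpa using hwK (t (φ n) + x) (t (φ n) + y))
  have hζcont : Continuous ζ := by
    apply LipschitzWith.continuous (K := (2 * K).toNNReal)
    apply LipschitzWith.of_dist_le'
    simpa [Real.dist_eq] using hζK
  have hζle : ∀ x, ζ x ≤ η := by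
    intro x
    apply le_of_forall_pos_lt_add
    intro e he
    have h1 : ∀ᶠ x in atTop, w x < η + e / 2 :=
      eventually_lt_of_limsup_lt (by linarith) hbdd
    have h2 := le_of_tendsto (hlim x) (((htx x).eventually h1).mono fun n hn => hn.le)
    linarith
  have hζ0 : ζ 0 = η := by
    apply le_antisymm (hζle 0)
    have h1 : Tendsto (fun n : ℕ => η - 1 / ((φ n : ℝ) + 1)) atTop (𝓝 (η - 0)) :=
      tendsto_const_nhds.sub (tendsto_one_div_add_atTop_nhds_zero_nat.comp hφ.tendsto_atTop)
    rw [sub_zero] at h1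
    exact le_of_tendsto_of_tendsto' h1 (hlim 0) fun n => by simpa using (ht2 (φ n)).le
  have hzint : ∀ x, Integrable (fun u => z (x - u)) P := fun x =>
    Integrable.of_bound (by fun_prop) C (Eventually.of_forall fun u => hC _)
  have hwren : ∀ x, w x = (g (x + s) - g x) + ∫ u, w (x - u) ∂P := by
    intro x
    have h1 : ∫ u, w (x - u) ∂P = (∫ u, z (x + s - u) ∂P) - ∫ u, z (x - u) ∂P := by
      rw [← integral_sub (hzint _) (hzint _)]
      congr 1; ext u; simp only [hw]; congr 2; ring
    rw [h1]
    have h2 := hren (x + s); have h3 := hren x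
    simp only [hw]; linarith
  have hharm : ∀ x, ζ x = ∫ u, ζ (x - u) ∂P := by
    intro x
    have h1 : Tendsto (fun n => ∫ u, w (t (φ n) + (x - u)) ∂P) atTop (𝓝 (∫ u, ζ (x - u) ∂P)) := by
      apply tendsto_integral_of_dominated_convergence (fun _ => 2 * C)
      · intro n
        apply Continuous.aestronglyMeasurable
        simp only [hw]; fun_prop
      · exact integrable_const _
      · exact fun n => Eventually.of_forall fun u => hwC _
      · exact Eventually.of_forall fun u => hlim _
    have h2 : Tendsto (fun n => g (t (φ n) + x + s) - g (t (φ n) + x)) atTop (𝓝 (0 - 0)) := by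
      apply Tendsto.sub
      · exact hg.comp (tendsto_atTop_add_const_right _ _ (htx x))
      · exact hg.comp (htx x)
    have h3 := h2.add h1
    rw [sub_zero, zero_add] at h3
    refine tendsto_nhds_unique (hlim x) (h3.congr fun n => ?_)
    rw [hwren (t (φ n) + x)]
    simp only [add_sub_assoc]
  obtain ⟨Y, hY⟩ := bw_maxprinciple P hpos hnonlattice ζ (2 * K) (2 * C) hζK hζcont hζC hharm
    (fun x => by rw [hζ0]; exact hζle x) (η / 2) (by linarith)
  have hsum : ∀ (N : ℕ) (x : ℝ), ∑ k ∈ Finset.range N, w (x + k * s) = z (x + N * s) - z x := by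
    intro N x
    induction N with
    | zero => simp
    | succ N ih => 
      rw [Finset.sum_range_succ, ih]; simp only [hw]
      have : x + (N:ℝ) * s + s = x + ((N + 1 : ℕ) : ℝ) * s := by push_cast; ring
      rw [this]; ring
  obtain ⟨N, hN⟩ := exists_nat_gt (2 * C / (η / 2))
  rw [div_lt_iff₀ (by linarith)] at hN
  set y0 : ℝ := |Y| + N * |s| with hy0
  have h1 : Tendsto (fun n => ∑ k ∈ Finset.range N, w (t (φ n) + (-y0 + k * s))) atTop
      (𝓝 (∑ k ∈ Finset.range N, ζ (-y0 + k * s))) :=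
    tendsto_finsetSum _ fun k _ => hlim _
  have h2 : ∑ k ∈ Finset.range N, ζ (-y0 + k * s) ≤ 2 * C := by
    refine le_of_tendsto h1 (Eventually.of_forall fun n => ?_)
    simp only [← add_assoc]
    rw [hsum]
    linarith [(abs_le.1 (hC (t (φ n) + -y0 + N * s))).2, (abs_le.1 (hC (t (φ n) + -y0))).1]
  have h3 : ∑ k ∈ Finset.range N, (η / 2) ≤ ∑ k ∈ Finset.range N, ζ (-y0 + k * s) := by
    apply Finset.sum_le_sum
    intro k hk
    have hk' : (k:ℝ) ≤ N := by exact_mod_cast (Finset.mem_range.1 hk).le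
    have h5 := hY (y0 - k * s) (by
      have h6 : (k:ℝ) * s ≤ N * |s| := by
        calc (k:ℝ) * s ≤ k * |s| := by gcongr; exact le_abs_self s
          _ ≤ N * |s| := by gcongr
      have := le_abs_self Y
      linarith)
    rw [hζ0] at h5
    have h7 : -(y0 - k * s) = -y0 + k * s := by ring
    rw [h7] at h5
    linarith
  rw [Finset.sum_const, Finset.card_range, nsmul_eq_mul] at h3
  linarith

open Topology in
theorem bw_diff (P : Measure ℝ) [IsProbabilityMeasure P]
    (hpos : ∀ᵐ x ∂P, 0 < x)
    (hnonlattice : ¬ ∃ α : ℝ, 0 < α ∧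
      P {x : ℝ | ∃ n : ℕ, 1 ≤ n ∧ x = α * n} = 1)
    (z g : ℝ → ℝ) (K C : ℝ) (hK : ∀ x y, |z x - z y| ≤ K * |x - y|)
    (hC : ∀ x, |z x| ≤ C) (hg : Tendsto g atTop (𝓝 0))
    (hren : ∀ x, z x = g x + ∫ u, z (x - u) ∂P) (s : ℝ) :
    Tendsto (fun x => z (x + s) - z x) atTop (𝓝 0) := by
  rw [Metric.tendsto_nhds]
  intro ε hε
  have h1 := bw_diff_upper P hpos hnonlattice z g K C hK hC hg hren s ε hε
  have h2 := bw_diff_upper P hpos hnonlattice (fun x => - z x) (fun x => - g x) K C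
    (fun x y => by
      have := hK x y
      rw [← abs_neg] at this
      convert this using 2; ring)
    (fun x => by simpa using hC x) (by simpa using hg.neg)
    (fun x => by rw [integral_neg, hren x]; ring) s ε hε
  filter_upwards [h1, h2] with x h1 h2
  rw [Real.dist_eq, sub_zero, abs_lt]
  constructor <;> linarith

theorem bw_prob (P : Measure ℝ) [IsProbabilityMeasure P] (n : ℕ) :
    IsProbabilityMeasure (convPow P n) := by
  induction n with
  | zero => rw [convPow]; infer_instance
  | succ n ih =>
    rw [convPow, convMeas]
    exact Measure.isProbabilityMeasure_map (by fun_prop)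

theorem bw_lint_succ (P : Measure ℝ) [IsProbabilityMeasure P] (n : ℕ) (f : ℝ → ENNReal)
    (hf : Measurable f) :
    ∫⁻ x, f x ∂(convPow P (n + 1)) = ∫⁻ x, ∫⁻ y, f (x + y) ∂P ∂(convPow P n) := by
  have := bw_prob P n
  rw [convPow, convMeas, lintegral_map hf (by fun_prop), lintegral_prod _ (by fun_prop)]

/-- The renewal measure. -/
noncomputable def bwU (P : Measure ℝ) : Measure ℝ := Measure.sum fun n : ℕ => convPow P n

theorem bwU_sfinite (P : Measure ℝ) [IsProbabilityMeasure P] : SFinite (bwU P) := by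
  have := bw_prob P
  unfold bwU
  infer_instance

theorem bwU_lint (P : Measure ℝ) [IsProbabilityMeasure P] (f : ℝ → ENNReal)
    (hf : Measurable f) :
    ∫⁻ x, f x ∂(bwU P) = f 0 + ∫⁻ x, ∫⁻ y, f (x + y) ∂P ∂(bwU P) := by
  rw [bwU, lintegral_sum_measure, lintegral_sum_measure, tsum_eq_zero_add' ENNReal.summable]
  congr 1
  · rw [convPow, lintegral_dirac' _ hf]
  · simp_rw [bw_lint_succ P _ f hf]

theorem bwU_nonneg (P : Measure ℝ) [IsProbabilityMeasure P] (hpos : ∀ᵐ x ∂P, 0 < x) :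
    ∀ᵐ x ∂(bwU P), 0 ≤ x := by
  have h : ∀ n, convPow P n (Iio 0) = 0 := by
    intro n
    induction n with
    | zero => simp [convPow]
    | succ n ih =>
      rw [← lintegral_indicator_one measurableSet_Iio,
        bw_lint_succ P n _ (measurable_one.indicator measurableSet_Iio)]
      have hn : ∀ᵐ x ∂(convPow P n), 0 ≤ x := by
        rw [ae_iff]; simpa [Iio] using ih
      rw [lintegral_congr_ae (g := fun _ => 0)]
      · simp
      · filter_upwards [hn] with x hx
        rw [lintegral_congr_ae (g := fun _ => 0)]
        · simp
        · filter_upwards [hpos] with y hy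
          rw [indicator_of_notMem]
          simp; linarith
  rw [bwU, Measure.ae_sum_iff]
  intro n
  rw [ae_iff]
  simpa [Iio] using h n

theorem bwU_finite (P : Measure ℝ) [IsProbabilityMeasure P] (hpos : ∀ᵐ x ∂P, 0 < x) (t : ℝ) :
    bwU P (Iic t) < ⊤ := by
  set f : ℝ → ENNReal := fun x => ENNReal.ofReal (Real.exp (-x)) with hf
  have hfm : Measurable f := by fun_prop
  set L := ∫⁻ x, f x ∂P with hL
  have hL1 : L < 1 := by
    have h1 : ∀ᵐ x ∂P, f x < 1 := by
      filter_upwards [hpos] with x hx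
      rw [hf]
      simp [hx]
    have h2 : L ≤ ∫⁻ x, 1 ∂P := lintegral_mono_ae (h1.mono fun x hx => hx.le)
    have h3 : ∫⁻ x, f x ∂P < ∫⁻ x, 1 ∂P := lintegral_strict_mono (IsProbabilityMeasure.ne_zero P)
      (by fun_prop) (ne_top_of_le_ne_top (by simp) h2) h1
    simpa using h3
  have hpow : ∀ n, ∫⁻ x, f x ∂(convPow P n) = L ^ n := by
    intro n
    induction n with
    | zero => rw [convPow, lintegral_dirac' _ hfm]; simp [hf]
    | succ n ih =>
      rw [bw_lint_succ P n f hfm]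
      have : ∀ x y, f (x + y) = f x * f y := by
        intro x y
        simp only [hf]
        rw [← ENNReal.ofReal_mul (Real.exp_pos _).le, ← Real.exp_add]
        congr 2; ring
      simp_rw [this, lintegral_const_mul _ hfm]
      rw [lintegral_mul_const _ hfm, ih, pow_succ]
  have hU : ∫⁻ x, f x ∂(bwU P) < ⊤ := by
    rw [bwU, lintegral_sum_measure]
    simp_rw [hpow]
    rw [ENNReal.tsum_geometric, ENNReal.inv_lt_top]
    exact tsub_pos_of_lt hL1
  have hm := mul_meas_ge_le_lintegral hfm (μ := bwU P) (f t)
  have hsub : Iic t ⊆ {x | f t ≤ f x} := by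
    intro x hx
    simp only [hf, mem_ofPred_eq]
    apply ENNReal.ofReal_le_ofReal
    apply Real.exp_le_exp.2
    simpa using hx
  have h1 : f t * bwU P (Iic t) < ⊤ := lt_of_le_of_lt (le_trans (by gcongr) hm) hU
  have h2 : f t ≠ 0 := by simp [hf, Real.exp_pos]
  by_contra h3
  rw [not_lt, top_le_iff] at h3
  rw [h3, ENNReal.mul_top h2] at h1
  exact lt_irrefl _ h1

/-- The tail function. -/
noncomputable def bwM (P : Measure ℝ) : ℝ → ENNReal := (Ici (0:ℝ)).indicator fun u => P (Ioi u)

theorem bwM_meas (P : Measure ℝ) : Measurable (bwM P) := by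
  apply Measurable.indicator _ measurableSet_Ici
  apply Antitone.measurable
  intro a b hab
  exact measure_mono (Ioi_subset_Ioi hab)

theorem bwM_conv (P : Measure ℝ) [IsProbabilityMeasure P] (hpos : ∀ᵐ x ∂P, 0 < x) (t : ℝ) :
    ∫⁻ y, bwM P (t - y) ∂(bwU P) = (Ici (0:ℝ)).indicator 1 t := by
  have hPneg : ∀ u < 0, P (Iic u) = 0 := by
    intro u hu
    rw [ae_iff] at hpos
    refine measure_mono_null (fun x hx => ?_) hpos
    simp only [mem_Iic, mem_ofPred_eq, not_lt] at *
    linarith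
  have hPm : Measurable fun u => P (Iic u) := by
    apply Monotone.measurable
    intro a b hab
    exact measure_mono (Iic_subset_Iic.2 hab)
  have h1 := bwU_lint P ((Iic t).indicator 1) (measurable_one.indicator measurableSet_Iic)
  rw [lintegral_indicator_one measurableSet_Iic] at h1
  have h2 : ∀ x, ∫⁻ y, (Iic t).indicator (1 : ℝ → ENNReal) (x + y) ∂P = P (Iic (t - x)) := by
    intro x
    rw [← lintegral_indicator_one measurableSet_Iic]
    congr 1; ext y
    simp only [indicator, mem_Iic, le_sub_iff_add_le, add_comm, Pi.one_apply]
  simp_rw [h2] at h1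
  have h3 : ∀ y, (Iic t).indicator (1 : ℝ → ENNReal) y = bwM P (t - y) + P (Iic (t - y)) := by
    intro y
    by_cases hy : y ≤ t
    · rw [indicator_of_mem (by simpa using hy), bwM, indicator_of_mem (by simpa using hy),
        ← compl_Iic, add_comm, measure_add_measure_compl measurableSet_Iic]
      simp
    · rw [indicator_of_notMem (by simpa using hy), bwM, indicator_of_notMem (by simpa using hy),
        hPneg _ (by linarith)]
      simp
  have h4 : bwU P (Iic t) = (∫⁻ y, bwM P (t - y) ∂(bwU P)) + ∫⁻ y, P (Iic (t - y)) ∂(bwU P) := by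
    rw [← lintegral_indicator_one measurableSet_Iic]
    simp_rw [h3]
    exact lintegral_add_left ((bwM_meas P).comp (measurable_const.sub measurable_id)) _
  have hfin := bwU_finite P hpos t
  rw [h1] at h4
  have h5 : ∫⁻ y, P (Iic (t - y)) ∂(bwU P) ≠ ⊤ := by
    apply ne_top_of_le_ne_top hfin.ne
    rw [h1]; exact le_add_self
  have h6 := (ENNReal.add_left_inj h5).1 h4
  rw [← h6]
  simp [indicator]

theorem bwU_bound (P : Measure ℝ) [IsProbabilityMeasure P] (hpos : ∀ᵐ x ∂P, 0 < x) (L : ℝ) :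
    ∃ C : ENNReal, C < ⊤ ∧ ∀ x, bwU P (Icc x (x + L)) ≤ C := by
  obtain ⟨δ, hδ, hc⟩ : ∃ δ : ℝ, 0 < δ ∧ P (Ioi δ) ≠ 0 := by
    by_contra hcon
    push Not at hcon
    have h1 : ∀ᵐ x ∂P, ∀ n : ℕ, x ≤ 1 / ((n:ℝ) + 1) := by
      rw [ae_all_iff]
      intro n
      rw [ae_iff]
      simpa [Ioi] using hcon (1 / ((n:ℝ) + 1)) (by positivity)
    obtain ⟨x, hx, hx0⟩ := (h1.and hpos).exists
    obtain ⟨n, hn⟩ := exists_nat_one_div_lt hx0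
    exact absurd (hx n) (not_le.2 hn)
  have hone : ∀ x, bwU P (Icc x (x + δ)) ≤ (P (Ioi δ))⁻¹ := by
    intro x
    have h1 : ∫⁻ y, (Icc x (x + δ)).indicator (fun _ => P (Ioi δ)) y ∂(bwU P) ≤ 1 := by
      calc _ ≤ ∫⁻ y, bwM P ((x + δ) - y) ∂(bwU P) := by
            apply lintegral_mono
            intro y
            apply indicator_le
            intro y hy
            rw [bwM, indicator_of_mem (by simpa using hy.2)]
            apply measure_mono
            apply Ioi_subset_Ioi
            linarith [hy.1]
        _ ≤ 1 := by
            rw [bwM_conv P hpos]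
            exact indicator_le (fun _ _ => le_rfl) _
    rw [lintegral_indicator_const measurableSet_Icc] at h1
    rw [← one_div, ENNReal.le_div_iff_mul_le (Or.inl hc) (Or.inl (measure_ne_top _ _)), mul_comm]
    exact h1
  have hN : ∀ (N : ℕ) x, bwU P (Icc x (x + N * δ)) ≤ ((N + 1 : ℕ) : ENNReal) * (P (Ioi δ))⁻¹ := by
    intro N x
    induction N with
    | zero =>
      simp only [Nat.cast_zero, zero_mul, zero_add, Nat.cast_one, one_mul]
      exact (measure_mono (Icc_subset_Icc_right (by linarith))).trans (hone x)
    | succ N ih =>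
      have hsub : Icc x (x + (N + 1 : ℕ) * δ) ⊆
          Icc x (x + N * δ) ∪ Icc (x + N * δ) (x + N * δ + δ) := by
        intro y hy
        push_cast at hy
        by_cases h : y ≤ x + N * δ
        · exact Or.inl ⟨hy.1, h⟩
        · exact Or.inr ⟨by linarith, by linarith [hy.2]⟩
      calc _ ≤ _ := measure_mono hsub
        _ ≤ _ := measure_union_le _ _
        _ ≤ _ := add_le_add ih (hone _)
        _ = _ := by push_cast; ring
  obtain ⟨N, hN'⟩ := exists_nat_gt (L / δ)
  rw [div_lt_iff₀ hδ] at hN'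
  refine ⟨((N + 1 : ℕ) : ENNReal) * (P (Ioi δ))⁻¹, ?_, fun x => ?_⟩
  · exact ENNReal.mul_lt_top (ENNReal.natCast_lt_top _) (by simpa using pos_iff_ne_zero.2 hc)
  · exact (measure_mono (Icc_subset_Icc_right (by linarith))).trans (hN N x)

theorem bwZ_meas (P : Measure ℝ) [IsProbabilityMeasure P] (G : ℝ → ENNReal) (hG : Measurable G) :
    Measurable fun x => ∫⁻ y, G (x - y) ∂(bwU P) := by
  have := bwU_sfinite P
  exact Measurable.lintegral_prod_right' (f := fun p : ℝ × ℝ => G (p.1 - p.2)) (by fun_prop)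

theorem bwZ_renewal (P : Measure ℝ) [IsProbabilityMeasure P] (G : ℝ → ENNReal) (hG : Measurable G)
    (x : ℝ) :
    ∫⁻ y, G (x - y) ∂(bwU P) = G x + ∫⁻ u, ∫⁻ y, G (x - u - y) ∂(bwU P) ∂P := by
  have := bwU_sfinite P
  rw [bwU_lint P (fun y => G (x - y)) (by fun_prop), sub_zero]
  congr 1
  rw [lintegral_lintegral_swap (by fun_prop)]
  simp only [sub_sub, add_comm]

theorem bwZ_tail (P : Measure ℝ) [IsProbabilityMeasure P] (hpos : ∀ᵐ x ∂P, 0 < x)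
    (G : ℝ → ENNReal) (hG : Measurable G) (x : ℝ) :
    ∫⁻ u, bwM P u * ∫⁻ y, G (x - u - y) ∂(bwU P) = ∫⁻ t, (Ici (0:ℝ)).indicator 1 t * G (x - t) := by
  have := bwU_sfinite P
  have hM := bwM_meas P
  calc _ = ∫⁻ u, ∫⁻ y, bwM P u * G (x - u - y) ∂(bwU P) := by
        congr 1; ext u; rw [lintegral_const_mul _ (by fun_prop)]
    _ = ∫⁻ y, (∫⁻ u, bwM P u * G (x - u - y)) ∂(bwU P) := by
        rw [lintegral_lintegral_swap (by fun_prop)]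
    _ = ∫⁻ y, (∫⁻ t, bwM P (t - y) * G (x - t)) ∂(bwU P) := by
        congr 1; ext y
        rw [← lintegral_sub_right_eq_self (μ := volume) _ y]
        congr 1; ext t; congr 2; ring
    _ = ∫⁻ t, (∫⁻ y, bwM P (t - y) * G (x - t) ∂(bwU P)) := by
        rw [lintegral_lintegral_swap (by fun_prop)]
    _ = _ := by
        congr 1; ext t
        rw [lintegral_mul_const _ (by fun_prop), bwM_conv P hpos]

theorem bwM_lint (P : Measure ℝ) (hpos : ∀ᵐ x ∂P, 0 < x) :
    ∫⁻ u, bwM P u = ∫⁻ x, ENNReal.ofReal x ∂P := by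
  rw [lintegral_eq_lintegral_meas_lt P (hpos.mono fun x hx => hx.le) (by fun_prop), bwM,
    lintegral_indicator measurableSet_Ici, setLIntegral_congr Ioi_ae_eq_Ici.symm]
  rfl

open Topology in
theorem bw_weight (z f : ℝ → ℝ) (C : ℝ) (hz : Continuous z) (hC : ∀ x, |z x| ≤ C)
    (hdiff : ∀ s, Tendsto (fun x => z (x + s) - z x) atTop (𝓝 0)) (hf : Integrable f) :
    Tendsto (fun x => (∫ u, f u * z (x - u)) - (∫ u, f u) * z x) atTop (𝓝 0) := by
  have h1 : Tendsto (fun x => ∫ u, f u * (z (x - u) - z x)) atTop (𝓝 (∫ u, f u * 0)) := by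
    apply tendsto_integral_filter_of_dominated_convergence (fun u => |f u| * (2 * C))
    · refine Eventually.of_forall fun x => ?_
      exact hf.aestronglyMeasurable.mul (Continuous.aestronglyMeasurable (by fun_prop))
    · refine Eventually.of_forall fun x => Eventually.of_forall fun u => ?_
      rw [Real.norm_eq_abs, abs_mul]
      gcongr
      have h1 := abs_le.1 (hC (x - u)); have h2 := abs_le.1 (hC x)
      rw [abs_le]; constructor <;> linarith [h1.1, h1.2, h2.1, h2.2]
    · exact hf.abs.mul_const _
    · refine Eventually.of_forall fun u => ?_
      exact (hdiff (-u)).const_mul (f u)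
  simp only [mul_zero, integral_zero] at h1
  refine h1.congr fun x => ?_
  have h2 : Integrable fun u => f u * z (x - u) :=
    hf.mul_bdd (c := C) (Continuous.aestronglyMeasurable (by fun_prop))
      (Eventually.of_forall fun u => hC _)
  rw [← integral_mul_const, ← integral_sub h2 (hf.mul_const _)]
  congr 1; ext u; ring

open Topology in
theorem bw_smooth (P : Measure ℝ) [IsProbabilityMeasure P]
    (hpos : ∀ᵐ x ∂P, 0 < x)
    (hnonlattice : ¬ ∃ α : ℝ, 0 < α ∧
      P {x : ℝ | ∃ n : ℕ, 1 ≤ n ∧ x = α * n} = 1)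
    (g : ℝ → ℝ) (K R : ℝ) (hK : ∀ x y, |g x - g y| ≤ K * |x - y|) (hgm : Continuous g)
    (hg0 : ∀ x, 0 ≤ g x) (hg1 : ∀ x, g x ≤ 1) (hgR : ∀ x, R < |x| → g x = 0) :
    Tendsto (fun x => (∫⁻ y, ENNReal.ofReal (g (x - y)) ∂(bwU P)).toReal) atTop
      (𝓝 ((∫⁻ x, ENNReal.ofReal (g x)).toReal / (∫⁻ x, ENNReal.ofReal x ∂P).toReal)) := by
  have hsf := bwU_sfinite P
  have hK0 : 0 ≤ K := by
    have := (abs_nonneg _).trans (hK 1 0)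
    simpa using this
  obtain ⟨C, hC, hCb⟩ := bwU_bound P hpos (2 * R)
  have hI : ∀ x, bwU P (Icc (x - R) (x + R)) ≤ C := by
    intro x
    convert hCb (x - R) using 3; ring
  set G : ℝ → ENNReal := fun x => ENNReal.ofReal (g x) with hG
  have hGm : Measurable G := by fun_prop
  set Z : ℝ → ENNReal := fun x => ∫⁻ y, G (x - y) ∂(bwU P) with hZ
  have hGzero : ∀ x y, y ∉ Icc (x - R) (x + R) → G (x - y) = 0 := by
    intro x y hy
    simp only [hG]
    rw [hgR, ENNReal.ofReal_zero]
    by_contra h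
    rw [not_lt, abs_le] at h
    exact hy ⟨by linarith [h.2], by linarith [h.1]⟩
  have hZC : ∀ x, Z x ≤ C := by
    intro x
    refine le_trans ?_ (hI x)
    rw [← lintegral_indicator_one measurableSet_Icc]
    apply lintegral_mono
    intro y
    by_cases hy : y ∈ Icc (x - R) (x + R)
    · rw [indicator_of_mem hy]; simpa [hG] using hg1 _
    · simp only [hGzero x y hy]; exact zero_le
  have hZtop : ∀ x, Z x ≠ ⊤ := fun x => ((hZC x).trans_lt hC).ne
  have hZL : ∀ x x', Z x ≤ Z x' + ENNReal.ofReal (K * |x - x'|) * C := by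
    intro x x'
    calc Z x ≤ ∫⁻ y, (G (x' - y) + (Icc (x - R) (x + R)).indicator
            (fun _ => ENNReal.ofReal (K * |x - x'|)) y) ∂(bwU P) := by
          apply lintegral_mono
          intro y
          by_cases hy : y ∈ Icc (x - R) (x + R)
          · simp only [indicator_of_mem hy, hG]
            rw [← ENNReal.ofReal_add (hg0 _) (by positivity)]
            apply ENNReal.ofReal_le_ofReal
            have := (abs_le.1 (hK (x - y) (x' - y))).2
            rw [sub_sub_sub_cancel_right] at this
            linarith
          · simp only [hGzero x y hy]; exact zero_le
      _ = Z x' + ENNReal.ofReal (K * |x - x'|) * bwU P (Icc (x - R) (x + R)) := by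
          rw [lintegral_add_left (by fun_prop), lintegral_indicator_const measurableSet_Icc]
      _ ≤ _ := by gcongr; exact hI x
  set z : ℝ → ℝ := fun x => (Z x).toReal with hz
  have hz0 : ∀ x, 0 ≤ z x := fun x => ENNReal.toReal_nonneg
  have hzC : ∀ x, |z x| ≤ C.toReal := fun x => by
    rw [abs_of_nonneg (hz0 x)]
    exact ENNReal.toReal_mono hC.ne (hZC x)
  have hzL1 : ∀ x x', z x ≤ z x' + K * C.toReal * |x - x'| := by
    intro x x'
    have h1 := ENNReal.toReal_mono (ENNReal.add_ne_top.2 ⟨hZtop x',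
      ENNReal.mul_ne_top ENNReal.ofReal_ne_top hC.ne⟩) (hZL x x')
    rw [ENNReal.toReal_add (hZtop x') (ENNReal.mul_ne_top ENNReal.ofReal_ne_top hC.ne),
      ENNReal.toReal_mul, ENNReal.toReal_ofReal (by positivity)] at h1
    simp only [hz]
    linarith
  have hzL : ∀ x x', |z x - z x'| ≤ K * C.toReal * |x - x'| := by
    intro x x'
    have h1 := hzL1 x x'
    have h2 := hzL1 x' x
    rw [abs_sub_comm] at h2
    rw [abs_le]; constructor <;> linarith
  have hzcont : Continuous z := by
    apply LipschitzWith.continuous (K := (K * C.toReal).toNNReal)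
    apply LipschitzWith.of_dist_le'
    simpa [Real.dist_eq] using hzL
  have hZm : Measurable Z := bwZ_meas P G hGm
  have hglim : Tendsto g atTop (𝓝 0) := by
    apply tendsto_const_nhds.congr'
    filter_upwards [eventually_gt_atTop R] with x hx
    exact (hgR x (hx.trans_le (le_abs_self x))).symm
  have hren : ∀ x, z x = g x + ∫ u, z (x - u) ∂P := by
    intro x
    have h1 := bwZ_renewal P G hGm x
    have h2 : ∫⁻ u, Z (x - u) ∂P ≠ ⊤ := by
      apply ne_top_of_le_ne_top (hZtop x)
      simp only [hZ]; rw [h1]; exact le_add_self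
    have h3 : ∫ u, z (x - u) ∂P = (∫⁻ u, Z (x - u) ∂P).toReal :=
      integral_toReal (by fun_prop) (Eventually.of_forall fun u => (hZtop _).lt_top)
    rw [h3]
    simp only [hz, hZ] at h2 ⊢
    rw [h1, ENNReal.toReal_add ENNReal.ofReal_ne_top h2, ENNReal.toReal_ofReal (hg0 x)]
  have hdiff := bw_diff P hpos hnonlattice z g _ _ hzL hzC hglim hren
  set I := ∫⁻ x, G x with hIdef
  have hItop : I ≠ ⊤ := by
    have : I ≤ volume (Icc (-R) R) := by
      rw [← lintegral_indicator_one measurableSet_Icc]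
      apply lintegral_mono
      intro y
      by_cases hy : y ∈ Icc (-R) R
      · rw [indicator_of_mem hy]; simpa [hG] using hg1 _
      · have h1 := hGzero 0 (-y) (fun h => hy ⟨by linarith [h.2], by linarith [h.1]⟩)
        simp only [sub_neg_eq_add, zero_add] at h1
        simp only [h1]; exact zero_le
    exact ne_top_of_le_ne_top (by simp) this
  have htail : ∀ x ≥ R, ∫⁻ u, bwM P u * Z (x - u) = I := by
    intro x hx
    simp only [hZ]
    rw [bwZ_tail P hpos G hGm x, hIdef, ← lintegral_sub_left_eq_self G x]
    congr 1; ext t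
    by_cases ht : t ∈ Ici (0:ℝ)
    · rw [indicator_of_mem ht]; simp
    · rw [hGzero]
      · simp
      · intro h
        simp only [mem_Ici, not_le] at ht
        linarith [h.1]
  have hMle : ∀ u, bwM P u ≤ 1 := fun u => indicator_le (fun _ _ => prob_le_one) _
  have hMtop : ∀ u, bwM P u ≠ ⊤ := fun u => ne_top_of_le_ne_top (by simp) (hMle u)
  have hMm := bwM_meas P
  have hmu := bwM_lint P hpos
  rw [← hmu]
  by_cases hfin : ∫⁻ u, bwM P u = ⊤
  ·
    rw [hfin, ENNReal.toReal_top, div_zero]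
    have key : ∀ N : ℕ, ∀ᶠ x in atTop,
        (∫⁻ u in Icc (-N:ℝ) N, bwM P u).toReal * z x ≤ I.toReal + 1 := by
      intro N
      set f : ℝ → ℝ := (Icc (-N:ℝ) N).indicator fun u => (bwM P u).toReal with hf
      have hfint : Integrable f := by
        rw [hf, integrable_indicator_iff measurableSet_Icc]
        apply Measure.integrableOn_of_bounded (M := 1) (by simp)
          hMm.ennreal_toReal.aestronglyMeasurable
        refine Eventually.of_forall fun u => ?_
        rw [Real.norm_eq_abs, abs_of_nonneg ENNReal.toReal_nonneg]
        simpa using ENNReal.toReal_mono (by simp) (hMle u)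
      have hfi : ∫ u, f u = (∫⁻ u in Icc (-N:ℝ) N, bwM P u).toReal := by
        rw [hf, integral_indicator measurableSet_Icc]
        exact integral_toReal (by fun_prop) (Eventually.of_forall fun u => (hMtop _).lt_top)
      have h1 := bw_weight z f C.toReal hzcont hzC hdiff hfint
      have h2 := h1.eventually (eventually_gt_nhds (show (-1:ℝ) < 0 by norm_num))
      filter_upwards [h2, eventually_ge_atTop R] with x h2 hx
      have h3 : ∫ u, f u * z (x - u) ≤ I.toReal := by
        rw [← htail x hx]
        have h4 : ∫ u, f u * z (x - u) = (∫⁻ u, ENNReal.ofReal (f u * z (x - u))).toReal := by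
          apply integral_eq_lintegral_of_nonneg_ae
          · refine Eventually.of_forall fun u => mul_nonneg ?_ (hz0 _)
            exact indicator_nonneg (fun _ _ => ENNReal.toReal_nonneg) _
          · exact hfint.aestronglyMeasurable.mul (Continuous.aestronglyMeasurable (by fun_prop))
        rw [h4]
        apply ENNReal.toReal_mono
        · rw [htail x hx]; exact hItop
        · apply lintegral_mono
          intro u
          simp only [hf]
          by_cases hu : u ∈ Icc (-N:ℝ) N
          · rw [indicator_of_mem hu, ENNReal.ofReal_mul ENNReal.toReal_nonneg,
              ENNReal.ofReal_toReal (hMtop _), ENNReal.ofReal_toReal (hZtop _)]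
          · rw [indicator_of_notMem hu]; simp
      rw [hfi] at h2
      linarith
    have hlim : Tendsto (fun N : ℕ => ∫⁻ u in Icc (-N:ℝ) N, bwM P u) atTop (𝓝 ⊤) := by
      rw [← hfin]
      have hun : (⋃ N : ℕ, Icc (-N:ℝ) N) = univ := by
        rw [eq_univ_iff_forall]
        intro x
        obtain ⟨N, hN⟩ := exists_nat_ge |x|
        exact mem_iUnion.2 ⟨N, abs_le.1 hN⟩
      have hmono : Monotone fun N : ℕ => Icc (-N:ℝ) N := by
        intro a b hab
        have : (a:ℝ) ≤ b := by exact_mod_cast hab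
        exact Icc_subset_Icc (by linarith) this
      have h1 := tendsto_measure_iUnion_atTop (μ := volume.withDensity (bwM P)) hmono
      rw [hun, withDensity_apply _ MeasurableSet.univ, setLIntegral_univ] at h1
      refine h1.congr fun N => ?_
      rw [Function.comp_apply, withDensity_apply _ measurableSet_Icc]
    rw [Metric.tendsto_nhds]
    intro ε hε
    have hNe : ∃ N : ℕ, ENNReal.ofReal ((I.toReal + 2) / ε) < ∫⁻ u in Icc (-N:ℝ) N, bwM P u :=
      (hlim.eventually (lt_mem_nhds ENNReal.ofReal_lt_top)).exists
    obtain ⟨N, hN⟩ := hNe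
    have hNtop : ∫⁻ u in Icc (-N:ℝ) N, bwM P u ≠ ⊤ := by
      have : ∫⁻ u in Icc (-N:ℝ) N, bwM P u ≤ ∫⁻ u in Icc (-N:ℝ) N, 1 := lintegral_mono hMle
      refine ne_top_of_le_ne_top ?_ this
      simp
    rw [ENNReal.ofReal_lt_iff_lt_toReal (by positivity) hNtop, div_lt_iff₀ hε] at hN
    filter_upwards [key N] with x hx
    rw [Real.dist_eq, sub_zero]
    rw [abs_of_nonneg (hz0 x)]
    by_contra hcon
    rw [not_lt] at hcon
    have : (∫⁻ u in Icc (-N:ℝ) N, bwM P u).toReal * ε ≤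
        (∫⁻ u in Icc (-N:ℝ) N, bwM P u).toReal * z x := by gcongr
    linarith
  · have hf : Integrable fun u => (bwM P u).toReal :=
      integrable_toReal_of_lintegral_ne_top (by fun_prop) hfin
    have hfi : ∫ u, (bwM P u).toReal = (∫⁻ u, bwM P u).toReal :=
      integral_toReal (by fun_prop) (Eventually.of_forall fun u => (hMtop _).lt_top)
    have h1 := bw_weight z _ C.toReal hzcont hzC hdiff hf
    have hmpos : 0 < (∫⁻ u, bwM P u).toReal := by
      apply ENNReal.toReal_pos _ hfin
      rw [hmu]
      intro h
      rw [lintegral_eq_zero_iff (by fun_prop)] at h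
      obtain ⟨x, hx, hx'⟩ := (h.and hpos).exists
      simp at hx
      linarith
    have h2 : Tendsto (fun x => I.toReal - (∫⁻ u, bwM P u).toReal * z x) atTop (𝓝 0) := by
      refine h1.congr' ?_
      filter_upwards [eventually_ge_atTop R] with x hx
      rw [hfi, ← htail x hx]
      congr 1
      rw [← integral_toReal (by fun_prop)
        (Eventually.of_forall fun u => (ENNReal.mul_ne_top (hMtop _) (hZtop _)).lt_top)]
      simp only [ENNReal.toReal_mul, hz]
    have h3 := (h2.const_sub I.toReal).div_const (∫⁻ u, bwM P u).toReal
    rw [sub_zero] at h3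
    refine h3.congr fun x => ?_
    rw [sub_sub_cancel, mul_div_cancel_left₀ _ hmpos.ne']

open Topology in
theorem bw_bump (P : Measure ℝ) [IsProbabilityMeasure P]
    (hpos : ∀ᵐ x ∂P, 0 < x)
    (hnonlattice : ¬ ∃ α : ℝ, 0 < α ∧
      P {x : ℝ | ∃ n : ℕ, 1 ≤ n ∧ x = α * n} = 1) (a b δ : ℝ) (hδ : 0 < δ) :
    ∃ g : ℝ → ℝ, (∀ x, 0 ≤ g x) ∧ (∀ x, g x ≤ 1) ∧ (∀ x ∈ Icc a b, g x = 1) ∧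
      (∀ x ∉ Ioo (a - δ) (b + δ), g x = 0) ∧
      b - a ≤ (∫⁻ x, ENNReal.ofReal (g x)).toReal ∧
      (∫⁻ x, ENNReal.ofReal (g x)).toReal ≤ max (b - a + 2 * δ) 0 ∧
      Tendsto (fun x => (∫⁻ y, ENNReal.ofReal (g (x - y)) ∂(bwU P)).toReal) atTop
      (𝓝 ((∫⁻ x, ENNReal.ofReal (g x)).toReal / (∫⁻ x, ENNReal.ofReal x ∂P).toReal)) := by
  set g : ℝ → ℝ := fun x => (thickenedIndicator hδ (Icc a b) x : ℝ) with hg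
  have hg0 : ∀ x, 0 ≤ g x := fun x => NNReal.coe_nonneg _
  have hg1 : ∀ x, g x ≤ 1 := fun x => by
    simp only [hg]; exact_mod_cast thickenedIndicator_le_one hδ _ x
  have hgI : ∀ x ∈ Icc a b, g x = 1 := fun x hx => by
    simp only [hg]; rw [thickenedIndicator_one hδ _ hx]; simp
  have hgz : ∀ x ∉ Ioo (a - δ) (b + δ), g x = 0 := fun x hx => by
    simp only [hg]; rw [thickenedIndicator_zero hδ]
    · simp
    · intro h
      rw [Metric.mem_thickening_iff] at h
      obtain ⟨p, hp, hd⟩ := h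
      rw [Real.dist_eq, abs_lt] at hd
      exact hx ⟨by linarith [hp.1, hd.1], by linarith [hp.2, hd.2]⟩
  have hlip : ∀ x y, |g x - g y| ≤ δ⁻¹ * |x - y| := fun x y => by
    have h1 := (lipschitzWith_thickenedIndicator hδ (Icc a b)).dist_le_mul x y
    rw [NNReal.dist_eq, Real.dist_eq] at h1
    rwa [NNReal.coe_inv, Real.coe_toNNReal δ hδ.le] at h1
  have hup : ∫⁻ x, ENNReal.ofReal (g x) ≤ volume (Ioo (a - δ) (b + δ)) := by
    rw [← lintegral_indicator_one measurableSet_Ioo]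
    apply lintegral_mono
    intro x
    by_cases hx : x ∈ Ioo (a - δ) (b + δ)
    · rw [indicator_of_mem hx]; simpa using hg1 x
    · simp only [hgz x hx]; simp
  have hlo : volume (Icc a b) ≤ ∫⁻ x, ENNReal.ofReal (g x) := by
    rw [← lintegral_indicator_one measurableSet_Icc]
    apply lintegral_mono
    intro x
    apply indicator_le
    intro x hx
    simp [hgI x hx]
  rw [Real.volume_Icc] at hlo
  rw [Real.volume_Ioo] at hup
  refine ⟨g, hg0, hg1, hgI, hgz, ?_, ?_, ?_⟩
  · have h1 := ENNReal.toReal_mono (ne_top_of_le_ne_top ENNReal.ofReal_ne_top hup) hlo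
    rw [ENNReal.toReal_ofReal'] at h1
    exact (le_max_left _ _).trans h1
  · have h1 := ENNReal.toReal_mono ENNReal.ofReal_ne_top hup
    rw [ENNReal.toReal_ofReal'] at h1
    convert h1 using 2; ring
  · refine bw_smooth P hpos hnonlattice g δ⁻¹ (|a - δ| + |b + δ|) hlip (by fun_prop) hg0 hg1 ?_
    intro x hx
    apply hgz
    intro h
    have h2 : |x| ≤ |a - δ| + |b + δ| := by
      rw [abs_le]
      constructor
      · linarith [h.1, neg_abs_le (a - δ), abs_nonneg (b + δ)]
      · linarith [h.2, le_abs_self (b + δ), abs_nonneg (a - δ)]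
    linarith

/-- Blackwell's renewal theorem: for a non-lattice probability measure `dP` on
`[0,∞)` with `dP({0}) = 0` and renewal measure `dQ = Σₙ dP^{*n}`, setting
`Q(x) = dQ([0,x])`, one has `Q(x+h) - Q(x) → h/∫₀^∞ x dP(x)` for every `h > 0`
(the limit being `0` when the mean is infinite). -/
theorem blackwell_renewal (P : Measure ℝ) [IsProbabilityMeasure P]
    (hsupp : P (Iio 0) = 0) (h0 : P ({0} : Set ℝ) = 0)
    (hnonlattice : ¬ ∃ α : ℝ, 0 < α ∧
      P {x : ℝ | ∃ n : ℕ, 1 ≤ n ∧ x = α * n} = 1)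
    (Q : ℝ → ℝ)
    (hQ : ∀ x : ℝ, Q x = ((Measure.sum fun n : ℕ => convPow P n) (Icc 0 x)).toReal)
    (h : ℝ) (hh : 0 < h) :
    Tendsto (fun x : ℝ => Q (x + h) - Q x) atTop
      (nhds (h / (∫⁻ x : ℝ, ENNReal.ofReal x ∂P).toReal)) := by
  have hpos : ∀ᵐ x ∂P, 0 < x := by
    rw [ae_iff]
    refine measure_mono_null (fun x hx => ?_) (measure_union_null hsupp h0)
    rcases lt_or_eq_of_le (not_lt.1 hx) with h1 | h1
    · exact Or.inl h1
    · exact Or.inr h1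
  have hQ' : ∀ x : ℝ, Q x = (bwU P (Icc 0 x)).toReal := hQ
  have hfin : ∀ s t : ℝ, bwU P (Icc s t) ≠ ⊤ := fun s t =>
    ((measure_mono Icc_subset_Iic_self).trans_lt (bwU_finite P hpos t)).ne
  have hfin' : ∀ s t : ℝ, bwU P (Ioc s t) ≠ ⊤ := fun s t =>
    ((measure_mono Ioc_subset_Iic_self).trans_lt (bwU_finite P hpos t)).ne
  have hdiff : ∀ x ≥ 0, Q (x + h) - Q x = (bwU P (Ioc x (x + h))).toReal := by
    intro x hx
    rw [hQ', hQ', ← Icc_union_Ioc_eq_Icc hx (show x ≤ x + h by linarith),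
      measure_union _ measurableSet_Ioc, ENNReal.toReal_add (hfin _ _) (hfin' _ _)]
    · ring
    · rw [Set.disjoint_left]
      intro y hy hy'
      exact absurd hy.2 (not_le.2 hy'.1)
  set mu := (∫⁻ x : ℝ, ENNReal.ofReal x ∂P).toReal with hmu
  have hmu0 : 0 ≤ mu := ENNReal.toReal_nonneg
  have hmi : 0 ≤ mu⁻¹ := inv_nonneg.2 hmu0
  rw [Metric.tendsto_nhds]
  intro ε hε
  set δ := ε / (4 * (mu⁻¹ + 1)) with hδ
  have hδ0 : 0 < δ := by positivity
  have hδε : 2 * δ * mu⁻¹ ≤ ε / 2 := by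
    have h1 : δ * (4 * (mu⁻¹ + 1)) = ε := by rw [hδ]; field_simp
    nlinarith
  obtain ⟨g, hg0, hg1, hgI, hgz, -, hgi, hglim⟩ := bw_bump P hpos hnonlattice (-h) 0 δ hδ0
  obtain ⟨k, hk0, hk1, hkI, hkz, hki, -, hklim⟩ := bw_bump P hpos hnonlattice (-h + δ) (-δ) δ hδ0
  rw [← hmu] at hglim hklim
  rw [max_eq_left (by linarith)] at hgi
  have hgm : (∫⁻ x, ENNReal.ofReal (g x)).toReal / mu < h / mu + ε := by
    rw [div_eq_mul_inv, div_eq_mul_inv]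
    have := mul_le_mul_of_nonneg_right hgi hmi
    linarith
  have hkm : h / mu - ε < (∫⁻ x, ENNReal.ofReal (k x)).toReal / mu := by
    rw [div_eq_mul_inv, div_eq_mul_inv]
    have := mul_le_mul_of_nonneg_right hki hmi
    linarith
  have hgtop : ∀ x, ∫⁻ y, ENNReal.ofReal (g (x - y)) ∂(bwU P) ≠ ⊤ := by
    intro x
    apply ne_top_of_le_ne_top (hfin (x - δ) (x + h + δ))
    rw [← lintegral_indicator_one measurableSet_Icc]
    apply lintegral_mono
    intro y
    by_cases hy : y ∈ Icc (x - δ) (x + h + δ)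
    · rw [indicator_of_mem hy]; simpa using hg1 _
    · simp only
      rw [hgz (x - y)]
      · simp
      · intro h1
        exact hy ⟨by linarith [h1.2], by linarith [h1.1]⟩
  filter_upwards [hglim.eventually (gt_mem_nhds hgm), hklim.eventually (lt_mem_nhds hkm),
    eventually_ge_atTop 0] with x h1 h2 hx
  rw [hdiff x hx]
  have hub : (bwU P (Ioc x (x + h))).toReal ≤
      (∫⁻ y, ENNReal.ofReal (g (x - y)) ∂(bwU P)).toReal := by
    apply ENNReal.toReal_mono (hgtop x)
    rw [← lintegral_indicator_one measurableSet_Ioc]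
    apply lintegral_mono
    intro y
    apply indicator_le
    intro y hy
    rw [hgI (x - y) ⟨by linarith [hy.2], by linarith [hy.1]⟩]
    simp
  have hlb : (∫⁻ y, ENNReal.ofReal (k (x - y)) ∂(bwU P)).toReal ≤
      (bwU P (Ioc x (x + h))).toReal := by
    apply ENNReal.toReal_mono (hfin' _ _)
    rw [← lintegral_indicator_one measurableSet_Ioc]
    apply lintegral_mono
    intro y
    by_cases hy : y ∈ Ioc x (x + h)
    · rw [indicator_of_mem hy]; simpa using hk1 _
    · simp only
      rw [hkz (x - y)]
      · simp
      · intro h1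
        exact hy ⟨by linarith [h1.2], by linarith [h1.1]⟩
  rw [Real.dist_eq, abs_lt]
  constructor <;> linarith
end

section
/- Let S ∈ L¹_loc[0,∞) and let φ : ℝ → ℝ be a nonzero, even, real-valued, continuous function with compact support whose Fourier transform φ̂(x) = ∫_{−∞}^{∞} φ(t) e^{−itx} dt is non-negative (so in particular φ̂ ∈ L¹(ℝ)). Then S(x) = O(e^x) as x → ∞ if and only if the following three conditions hold: (i) S is log-linearly boundedly decreasing; (ii) the Laplace transform 𝓛{S;s} = ∫₀^∞ e^{−sx} S(x) dx converges for every s with Re s > 1; (iii) there is a sequence σ_n → 1⁺ such that for each h > 0 the limit 𝔍_φ(h) = lim_{n→∞} ∫_{−∞}^{∞} (Re 𝓛{S;σ_n+it}) φ(t) cos(ht) dt exists and 𝔍_φ(h) = O(1) as h → ∞. -/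
open MeasureTheory Filter Set Asymptotics

/-- The Laplace transform `𝓛{S;s} = ∫₀^∞ e^{-sx} S(x) dx`. -/
noncomputable def laplaceT (S : ℝ → ℝ) (s : ℂ) : ℂ :=
  ∫ x in Ioi (0 : ℝ), Complex.exp (-s * x) * (S x : ℂ)

/-- `S` is log-linearly boundedly decreasing:
`liminf_{x→∞} inf_{y∈[x,x+h]} (S(y)-S(x))/e^x > -∞` for some `h > 0`. -/
def LogLinBoundedlyDecreasing (S : ℝ → ℝ) : Prop :=
  ∃ h : ℝ, 0 < h ∧ ∃ M : ℝ, ∃ x₁ : ℝ, ∀ x : ℝ, x₁ ≤ x → ∀ y ∈ Icc x (x + h),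
    M ≤ (S y - S x) / Real.exp x

/-- The cosine transform of `φ`. -/
noncomputable def gT (φ : ℝ → ℝ) (x : ℝ) : ℝ := ∫ t : ℝ, φ t * Real.cos (t * x)

lemma gT_cont {φ : ℝ → ℝ} (hc : Continuous φ) (hi : Integrable φ) : Continuous (gT φ) := by
  unfold gT
  refine continuous_of_dominated (bound := fun t => ‖φ t‖) ?_ ?_ hi.norm ?_
  · intro x
    exact Continuous.aestronglyMeasurable (by fun_prop)
  · intro x
    refine Eventually.of_forall fun t => ?_
    rw [norm_mul]
    exact mul_le_of_le_one_right (norm_nonneg _) (Real.abs_cos_le_one _)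
  · exact Eventually.of_forall fun t => by fun_prop

lemma gT_bound {φ : ℝ → ℝ} (hi : Integrable φ) (x : ℝ) : |gT φ x| ≤ ∫ t, |φ t| := by
  unfold gT
  refine norm_integral_le_of_norm_le (f := fun t : ℝ => φ t * Real.cos (t * x)) hi.abs ?_
  refine Eventually.of_forall fun t => ?_
  rw [norm_mul]
  exact mul_le_of_le_one_right (norm_nonneg _) (Real.abs_cos_le_one _)

lemma fourier_eq_gT {φ : ℝ → ℝ} (hc : Continuous φ) (hi : Integrable φ)
    (he : ∀ t, φ (-t) = φ t) (w : ℝ) :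
    FourierTransform.fourier (fun t => (φ t : ℂ)) w = (gT φ (2 * Real.pi * w) : ℂ) := by
  have hodd : ∫ t : ℝ, φ t * Real.sin (t * (2 * Real.pi * w)) = 0 := by
    have h := integral_neg_eq_self (fun t : ℝ => φ t * Real.sin (t * (2 * Real.pi * w))) volume
    simp only [he, neg_mul, Real.sin_neg, mul_neg, integral_neg] at h
    simp only [mul_assoc] at h ⊢
    linarith
  rw [Real.fourier_real_eq_integral_exp_smul]
  have h1 : Integrable (fun t : ℝ => φ t * Real.cos (t * (2 * Real.pi * w))) := by
    refine hi.mono (Continuous.aestronglyMeasurable (by fun_prop)) (Eventually.of_forall fun t => ?_)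
    rw [norm_mul]
    exact mul_le_of_le_one_right (norm_nonneg _) (Real.abs_cos_le_one _)
  have h2 : Integrable (fun t : ℝ => φ t * Real.sin (t * (2 * Real.pi * w))) := by
    refine hi.mono (Continuous.aestronglyMeasurable (by fun_prop)) (Eventually.of_forall fun t => ?_)
    rw [norm_mul]
    exact mul_le_of_le_one_right (norm_nonneg _) (Real.abs_sin_le_one _)
  have : ∀ t : ℝ, Complex.exp (↑(-2 * Real.pi * t * w) * Complex.I) • (φ t : ℂ)
      = ((φ t * Real.cos (t * (2 * Real.pi * w)) : ℝ) : ℂ)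
        - ((φ t * Real.sin (t * (2 * Real.pi * w)) : ℝ) : ℂ) * Complex.I := by
    intro t
    rw [Complex.exp_mul_I, ← Complex.ofReal_cos, ← Complex.ofReal_sin,
      show -2 * Real.pi * t * w = -(t * (2 * Real.pi * w)) by ring, Real.cos_neg, Real.sin_neg]
    push_cast
    simp only [smul_eq_mul]
    ring
  simp_rw [this]
  rw [integral_sub h1.ofReal (h2.ofReal.mul_const _), integral_mul_const, integral_complex_ofReal, integral_complex_ofReal,
    hodd]
  simp [gT]

lemma gT_ne {φ : ℝ → ℝ} (hc : Continuous φ) (hi : Integrable φ)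
    (he : ∀ t, φ (-t) = φ t) (hne : φ ≠ 0) : ∃ x, gT φ x ≠ 0 := by
  by_contra! h
  have hF : FourierTransform.fourier (fun t => (φ t : ℂ)) = 0 := by
    ext w
    rw [fourier_eq_gT hc hi he, h]; simp
  have hcc : Continuous (fun t => (φ t : ℂ)) := by fun_prop
  have := hcc.fourierInv_fourier_eq hi.ofReal (by rw [hF]; exact integrable_zero _ _ _)
  apply hne
  ext t
  have h2 := congrFun this t
  rw [hF, Real.fourierInv_eq] at h2
  simp at h2
  simpa using h2.symm

lemma gauss_cos_bound {b : ℝ} (hb : 0 < b) (t : ℝ) :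
    |∫ x : ℝ, Real.cos (t * x) * Real.exp (-b * x ^ 2)|
      ≤ √(Real.pi / b) * Real.exp (-(1 / (4 * b)) * t ^ 2) := by
  have h := fourierIntegral_gaussian (b := (b : ℂ)) (by simpa using hb) (t : ℂ)
  have hI : Integrable (fun x : ℝ => Complex.exp (Complex.I * t * x) * Complex.exp (-b * (x:ℂ) ^ 2)) := by
    refine (integrable_exp_neg_mul_sq hb).mono (Continuous.aestronglyMeasurable (by fun_prop)) (Eventually.of_forall fun x => ?_)
    rw [norm_mul, show Complex.I * t * x = ((t * x : ℝ) : ℂ) * Complex.I by push_cast; ring,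
      Complex.norm_exp_ofReal_mul_I, one_mul, Complex.norm_exp, Real.norm_eq_abs, abs_of_pos (Real.exp_pos _)]
    apply le_of_eq
    congr 1
    norm_cast
  have h3 : ∫ x : ℝ, Real.cos (t * x) * Real.exp (-b * x ^ 2)
      = (∫ x : ℝ, Complex.exp (Complex.I * t * x) * Complex.exp (-b * (x:ℂ) ^ 2)).re := by
    rw [← RCLike.re_eq_complex_re, ← integral_re hI]
    refine integral_congr_ae (Eventually.of_forall fun x => ?_)
    simp only [RCLike.re_eq_complex_re]
    rw [show Complex.I * t * x = ((t * x : ℝ) : ℂ) * Complex.I by push_cast; ring,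
      show (-b * (x:ℂ)^2) = ((-b * x ^ 2 : ℝ) : ℂ) by push_cast; ring, ← Complex.ofReal_exp,
      Complex.re_mul_ofReal, Complex.exp_ofReal_mul_I_re]
  rw [h3]
  refine (Complex.abs_re_le_norm _).trans ?_
  rw [h, norm_mul]
  refine mul_le_mul (le_of_eq ?_) (le_of_eq ?_) (norm_nonneg _) (Real.sqrt_nonneg _)
  · rw [← Complex.ofReal_div, show (1 / 2 : ℂ) = ((1 / 2 : ℝ) : ℂ) by norm_num,
      Complex.norm_cpow_eq_rpow_re_of_pos (by positivity), Real.sqrt_eq_rpow]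
    simp
  · rw [Complex.norm_exp]
    congr 1
    rw [show (-(t:ℂ) ^ 2 / (4 * b)) = ((-(t:ℝ) ^ 2 / (4 * b) : ℝ) : ℂ) by push_cast; ring,
      Complex.ofReal_re]
    ring

lemma gT_integrable {φ : ℝ → ℝ} (hc : Continuous φ) (hs : HasCompactSupport φ)
    (hg : ∀ x, 0 ≤ gT φ x) : Integrable (gT φ) := by
  have hi : Integrable φ := hc.integrable_of_hasCompactSupport hs
  have hgc := gT_cont hc hi
  obtain ⟨M, hM⟩ := hs.exists_bound_of_continuous hc
  have hM0 : 0 ≤ M := (norm_nonneg _).trans (hM 0)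
  have key : ∀ b : ℝ, 0 < b → ∫ x, gT φ x * Real.exp (-b * x ^ 2) ≤ M * (2 * Real.pi) := by
    intro b hb
    have hprod : Integrable (Function.uncurry fun x t : ℝ =>
        φ t * Real.cos (t * x) * Real.exp (-b * x ^ 2)) (volume.prod volume) := by
      refine ((integrable_exp_neg_mul_sq hb).mul_prod hi).mono
        (Continuous.aestronglyMeasurable (by fun_prop)) (Eventually.of_forall fun z => ?_)
      simp only [Function.uncurry, norm_mul]
      rw [mul_comm]
      gcongr
      exact mul_le_of_le_one_right (norm_nonneg _) (Real.abs_cos_le_one _)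
    have e1 : ∫ x, gT φ x * Real.exp (-b * x ^ 2)
        = ∫ t, φ t * ∫ x, Real.cos (t * x) * Real.exp (-b * x ^ 2) := by
      simp only [gT, ← integral_mul_const, ← integral_const_mul]
      rw [integral_integral_swap hprod]
      simp only [mul_assoc]
    rw [e1]
    have hb' : 0 < 1 / (4 * b) := by positivity
    refine (Real.le_norm_self _).trans ?_
    refine (norm_integral_le_of_norm_le (((integrable_exp_neg_mul_sq hb').const_mul
      (√(Real.pi / b))).const_mul M) (Eventually.of_forall fun t => ?_)).trans ?_
    · rw [norm_mul]
      exact mul_le_mul (hM t) (gauss_cos_bound hb t) (norm_nonneg _) hM0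
    · rw [integral_const_mul, integral_const_mul, integral_gaussian, ← Real.sqrt_mul (by positivity)]
      apply le_of_eq
      congr 1
      rw [show Real.pi / b * (Real.pi / (1 / (4 * b))) = (2 * Real.pi) ^ 2 by field_simp; norm_num]
      exact Real.sqrt_sq (by positivity)
  refine integrable_of_intervalIntegral_norm_bounded (l := atTop) (a := fun R : ℝ => -R)
    (b := fun R : ℝ => R)
    (Real.exp 1 * (M * (2 * Real.pi))) (fun R => (hgc.integrableOn_Icc).mono_set Ioc_subset_Icc_self)
    tendsto_neg_atTop_atBot tendsto_id ?_
  filter_upwards [eventually_gt_atTop 0] with R hR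
  have hb : 0 < 1 / R ^ 2 := by positivity
  rw [intervalIntegral.integral_of_le (by linarith)]
  obtain ⟨B, hB⟩ : ∃ B, ∀ x, |gT φ x| ≤ B := ⟨_, gT_bound hi⟩
  have hint : Integrable (fun x => gT φ x * Real.exp (-(1 / R ^ 2) * x ^ 2)) := by
    refine (((integrable_exp_neg_mul_sq hb)).const_mul B).mono
      (Continuous.aestronglyMeasurable (by fun_prop)) (Eventually.of_forall fun z => ?_)
    simp only [norm_mul]
    gcongr
    exact (hB z).trans (le_abs_self _)
  calc ∫ x in Ioc (-R) R, ‖gT φ x‖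
      ≤ ∫ x in Ioc (-R) R, Real.exp 1 * (gT φ x * Real.exp (-(1 / R ^ 2) * x ^ 2)) := by
        refine setIntegral_mono_on ((hgc.norm.integrableOn_Icc).mono_set Ioc_subset_Icc_self)
          (hint.const_mul _).integrableOn measurableSet_Ioc fun x hx => ?_
        rw [Real.norm_of_nonneg (hg x), mul_left_comm, ← Real.exp_add]
        refine le_mul_of_one_le_right (hg x) (Real.one_le_exp ?_)
        have : x ^ 2 ≤ R ^ 2 := by rw [sq_le_sq, abs_of_pos hR, abs_le]; exact ⟨hx.1.le, hx.2⟩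
        have : 1 / R ^ 2 * x ^ 2 ≤ 1 := by
          rw [one_div, inv_mul_le_iff₀ (by positivity)]; linarith
        linarith
    _ ≤ ∫ x, Real.exp 1 * (gT φ x * Real.exp (-(1 / R ^ 2) * x ^ 2)) := by
        refine setIntegral_le_integral (hint.const_mul _) (Eventually.of_forall fun x => ?_)
        have := hg x
        simp only [Pi.zero_apply]
        positivity
    _ ≤ _ := by
        rw [integral_const_mul]
        gcongr
        exact key _ hb

/-- The kernel `(φ̂(x-h)+φ̂(x+h))/2`. -/
noncomputable def kT (φ : ℝ → ℝ) (h x : ℝ) : ℝ := (gT φ (x - h) + gT φ (x + h)) / 2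

lemma kT_eq {φ : ℝ → ℝ} (hc : Continuous φ) (hi : Integrable φ) (h x : ℝ) :
    ∫ t, φ t * Real.cos (h * t) * Real.cos (t * x) = kT φ h x := by
  have hI : ∀ y, Integrable (fun t : ℝ => φ t * Real.cos (t * y)) := by
    intro y
    refine hi.mono (Continuous.aestronglyMeasurable (by fun_prop)) (Eventually.of_forall fun t => ?_)
    rw [norm_mul]
    exact mul_le_of_le_one_right (norm_nonneg _) (Real.abs_cos_le_one _)
  unfold kT gT
  rw [← integral_add (hI _) (hI _), ← integral_div]
  refine integral_congr_ae (Eventually.of_forall fun t => ?_)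
  simp only
  rw [mul_sub, mul_add, Real.cos_sub, Real.cos_add, mul_comm h t]
  ring

lemma kT_cont {φ : ℝ → ℝ} (hc : Continuous φ) (hi : Integrable φ) (h : ℝ) :
    Continuous (kT φ h) := by
  have := gT_cont hc hi
  unfold kT
  fun_prop

lemma kT_bound {φ : ℝ → ℝ} (hi : Integrable φ) (h x : ℝ) : |kT φ h x| ≤ ∫ t, |φ t| := by
  have h1 := abs_le.1 (gT_bound hi (x - h))
  have h2 := abs_le.1 (gT_bound hi (x + h))
  unfold kT
  rw [abs_le]
  constructor <;> linarith [h1.1, h1.2, h2.1, h2.2]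

lemma kT_nonneg {φ : ℝ → ℝ} (hg : ∀ x, 0 ≤ gT φ x) (h x : ℝ) : 0 ≤ kT φ h x := by
  have := hg (x - h)
  have := hg (x + h)
  unfold kT
  positivity

lemma kT_integrable {φ : ℝ → ℝ} (hg : Integrable (gT φ)) (h : ℝ) : Integrable (kT φ h) :=
  ((hg.comp_sub_right h).add (hg.comp_add_right h)).div_const 2

lemma kT_integral {φ : ℝ → ℝ} (hg : Integrable (gT φ)) (h : ℝ) :
    ∫ x, kT φ h x = ∫ x, gT φ x := by
  unfold kT
  rw [integral_div, integral_add (hg.comp_sub_right h) (hg.comp_add_right h),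
    integral_sub_right_eq_self (gT φ) h, integral_add_right_eq_self (gT φ) h]
  ring

lemma kT_setIntegral {φ : ℝ → ℝ} (hg : Integrable (gT φ)) (hg0 : ∀ x, 0 ≤ gT φ x) (h : ℝ) :
    ∫ x in Ioi (0:ℝ), kT φ h x ≤ ∫ x, gT φ x := by
  rw [← kT_integral hg h]
  exact setIntegral_le_integral (kT_integrable hg h) (Eventually.of_forall fun x => kT_nonneg hg0 h x)

lemma real_integrable {S : ℝ → ℝ} {σ : ℝ}
    (hI : IntegrableOn (fun x : ℝ => Complex.exp (-(σ : ℂ) * x) * (S x : ℂ)) (Ioi 0)) :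
    IntegrableOn (fun x : ℝ => S x * Real.exp (-σ * x)) (Ioi 0) := by
  have := hI.re
  refine this.congr (Eventually.of_forall fun x => ?_)
  simp only [RCLike.re_eq_complex_re]
  rw [Complex.re_mul_ofReal, show (-(σ : ℂ) * x) = ((-σ * x : ℝ) : ℂ) by push_cast; ring,
    Complex.exp_ofReal_re]
  ring

lemma laplace_re {S : ℝ → ℝ} {σ : ℝ}
    (hI : IntegrableOn (fun x : ℝ => S x * Real.exp (-σ * x)) (Ioi 0)) (t : ℝ) :
    (laplaceT S (σ + t * Complex.I)).re
      = ∫ x in Ioi (0:ℝ), S x * Real.exp (-σ * x) * Real.cos (t * x) := by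
  have he : ∀ x : ℝ, Complex.exp (-(σ + t * Complex.I) * x) * (S x : ℂ)
      = Complex.exp (((-(t * x) : ℝ) : ℂ) * Complex.I) * ((S x * Real.exp (-σ * x) : ℝ) : ℂ) := by
    intro x
    push_cast
    rw [show -(σ + t * Complex.I) * (x:ℂ) = -(t * x) * Complex.I + -σ * x by ring, Complex.exp_add]
    ring
  unfold laplaceT
  simp_rw [he]
  have hC : IntegrableOn (fun x : ℝ => Complex.exp (((-(t * x) : ℝ) : ℂ) * Complex.I)
      * ((S x * Real.exp (-σ * x) : ℝ) : ℂ)) (Ioi 0) := by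
    refine Integrable.bdd_mul (c := 1) hI.ofReal (Continuous.aestronglyMeasurable (by fun_prop))
      (Eventually.of_forall fun x => ?_)
    rw [Complex.norm_exp_ofReal_mul_I]
  rw [← RCLike.re_eq_complex_re, ← integral_re hC]
  refine integral_congr_ae (Eventually.of_forall fun x => ?_)
  simp only [RCLike.re_eq_complex_re]
  rw [Complex.re_mul_ofReal, Complex.exp_ofReal_mul_I_re, Real.cos_neg]
  ring

lemma key_identity {S φ : ℝ → ℝ} {σ : ℝ} (hc : Continuous φ) (hi : Integrable φ)
    (hI : IntegrableOn (fun x : ℝ => S x * Real.exp (-σ * x)) (Ioi 0)) (h : ℝ) :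
    ∫ t : ℝ, (laplaceT S (σ + t * Complex.I)).re * φ t * Real.cos (h * t)
      = ∫ x in Ioi (0:ℝ), S x * Real.exp (-σ * x) * kT φ h x := by
  simp_rw [laplace_re hI, mul_assoc _ (φ _), ← integral_mul_const]
  have hprod : Integrable (Function.uncurry fun t x : ℝ =>
      S x * Real.exp (-σ * x) * Real.cos (t * x) * (φ t * Real.cos (h * t)))
      (volume.prod (volume.restrict (Ioi 0))) := by
    have h0 := hi.mul_prod hI
    have h1 : Integrable (fun z : ℝ × ℝ => (Real.cos (z.1 * z.2) * Real.cos (h * z.1)) *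
        (φ z.1 * (S z.2 * Real.exp (-σ * z.2)))) (volume.prod (volume.restrict (Ioi 0))) := by
      refine Integrable.bdd_mul (c := 1) h0 (Continuous.aestronglyMeasurable (by fun_prop))
        (Eventually.of_forall fun z => ?_)
      rw [norm_mul]
      exact mul_le_one₀ (Real.abs_cos_le_one _) (norm_nonneg _) (Real.abs_cos_le_one _)
    refine h1.congr (Eventually.of_forall fun z => ?_)
    simp only [Function.uncurry]
    ring
  rw [integral_integral_swap hprod]
  refine integral_congr_ae (Eventually.of_forall fun x => ?_)
  simp only
  rw [← kT_eq hc hi, ← integral_const_mul]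
  refine integral_congr_ae (Eventually.of_forall fun t => ?_)
  simp only
  ring

lemma iterate_bound {S : ℝ → ℝ} (hL : LogLinBoundedlyDecreasing S) :
    ∃ C x₁ : ℝ, 0 ≤ C ∧ 0 ≤ x₁ ∧ ∀ x y, x₁ ≤ x → x ≤ y → S x - C * Real.exp y ≤ S y := by
  obtain ⟨h, hh, M, x₁, H⟩ := hL
  set D := max 0 (-M) with hD
  have hD0 : 0 ≤ D := le_max_left _ _
  have hDM : -M ≤ D := le_max_right _ _
  have H' : ∀ x, x₁ ≤ x → ∀ y ∈ Icc x (x + h), S x - D * Real.exp x ≤ S y := by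
    intro x hx y hy
    have h1 := H x hx y hy
    rw [le_div_iff₀ (Real.exp_pos x)] at h1
    nlinarith [Real.exp_pos x]
  set q := Real.exp (-h) with hq
  have hq0 : 0 < q := Real.exp_pos _
  have hq1 : q < 1 := by rw [hq, Real.exp_lt_one_iff]; linarith
  have hC : ∃ C, 0 ≤ C ∧ C * (1 - q) = D :=
    ⟨D / (1 - q), div_nonneg hD0 (by linarith), div_mul_cancel₀ _ (by linarith)⟩
  obtain ⟨C, hC0, hC⟩ := hC
  have ind : ∀ n : ℕ, ∀ x y, x₁ ≤ x → x ≤ y → y ≤ x + n * h → S x - C * Real.exp y ≤ S y := by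
    intro n
    induction n with
    | zero =>
      intro x y hx hxy hy
      have : y = x := by simp at hy; linarith
      subst this
      have := Real.exp_pos y
      have := mul_nonneg hC0 this.le
      linarith
    | succ n ih =>
      intro x y hx hxy hy
      push_cast at hy
      rcases le_total y (x + h) with hle | hle
      · have h1 := H' x hx y ⟨hxy, hle⟩
        have h2 := Real.exp_le_exp.2 hxy
        have h3 : D ≤ C := by nlinarith
        have h4 := mul_le_mul h3 h2 (Real.exp_pos _).le hC0
        linarith
      · have h1 := ih x (y - h) hx (by linarith) (by linarith)
        have h2 := H' (y - h) (by linarith) y ⟨by linarith, by linarith⟩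
        have h3 : Real.exp (y - h) = q * Real.exp y := by
          rw [hq, ← Real.exp_add]; congr 1; ring
        rw [h3] at h1 h2
        have h4 : (C + D) * q ≤ C := by nlinarith
        have h5 := mul_le_mul_of_nonneg_right h4 (Real.exp_pos y).le
        nlinarith
  refine ⟨C, max x₁ 0, hC0, le_max_right _ _, fun x y hx hxy => ?_⟩
  obtain ⟨n, hn⟩ := exists_nat_ge ((y - x) / h)
  rw [div_le_iff₀ hh] at hn
  exact ind n x y ((le_max_left _ _).trans hx) hxy (by linarith)

lemma locInt {S : ℝ → ℝ} (hS : LocallyIntegrableOn S (Ici 0)) (X : ℝ) :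
    IntegrableOn (fun x => |S x|) (Ioc 0 X) := by
  have : IntegrableOn S (Icc 0 X) :=
    hS.integrableOn_compact_subset Icc_subset_Ici_self isCompact_Icc
  exact (this.mono_set Ioc_subset_Icc_self).abs

lemma locInt_ind {S : ℝ → ℝ} (hS : LocallyIntegrableOn S (Ici 0)) (X : ℝ) :
    IntegrableOn (indicator (Ioc 0 X) (fun x => |S x|)) (Ioi 0) :=
  ((integrable_indicator_iff measurableSet_Ioc).2 (locInt hS X)).integrableOn

lemma backward_ineq {S φ : ℝ → ℝ} (hS : LocallyIntegrableOn S (Ici 0))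
    (hc : Continuous φ) (hi : Integrable φ) (hg : Integrable (gT φ)) (hg0 : ∀ x, 0 ≤ gT φ x)
    {x₁ C δ α β σ h s : ℝ} (hx₁ : 0 ≤ x₁) (hC : 0 ≤ C) (hδ : 0 ≤ δ) (hαβ : α ≤ β)
    (hδg : ∀ x ∈ Icc α β, δ ≤ gT φ x) (hσ : 1 < σ)
    (hI : IntegrableOn (fun x : ℝ => S x * Real.exp (-σ * x)) (Ioi 0))
    (hpos : ∀ x, x₁ ≤ x → 0 ≤ S x + C * Real.exp x) (hs : 0 ≤ s) (hh : x₁ < h + α)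
    (hmon : ∀ x, h + α ≤ x → s ≤ S x + C * Real.exp x) :
    s * Real.exp (-σ * (h + β)) * (δ / 2) * (β - α)
      ≤ (∫ x in Ioi (0:ℝ), S x * Real.exp (-σ * x) * kT φ h x)
        + (∫ t, |φ t|) * (∫ x in Ioi (0:ℝ), indicator (Ioc 0 x₁) (fun x => |S x|) x)
        + C * ∫ x, gT φ x := by
  set B := ∫ t, |φ t| with hB
  have hkI := (kT_integrable hg h).integrableOn (s := Ioi 0)
  have i1 : IntegrableOn (fun x => S x * Real.exp (-σ * x) * kT φ h x) (Ioi 0) :=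
    Integrable.mul_bdd (c := B) hI (kT_cont hc hi h).aestronglyMeasurable
      (Eventually.of_forall fun x => kT_bound hi h x)
  have i2 := (locInt_ind hS x₁).const_mul B
  have i12 : IntegrableOn (fun x => S x * Real.exp (-σ * x) * kT φ h x
      + B * indicator (Ioc 0 x₁) (fun x => |S x|) x) (Ioi 0) := i1.add i2
  have i3 : IntegrableOn (indicator (Icc (h + α) (h + β))
      (fun _ => s * Real.exp (-σ * (h + β)) * (δ / 2))) (Ioi 0) := by
    apply Integrable.integrableOn
    rw [integrable_indicator_iff measurableSet_Icc]
    exact integrableOn_const (by simp)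
  have e3 : ∫ x in Ioi (0:ℝ), indicator (Icc (h + α) (h + β))
      (fun _ => s * Real.exp (-σ * (h + β)) * (δ / 2)) x
      = s * Real.exp (-σ * (h + β)) * (δ / 2) * (β - α) := by
    rw [setIntegral_indicator measurableSet_Icc, inter_eq_self_of_subset_right, setIntegral_const]
    · simp [measureReal_def, hαβ]
      ring
    · intro x hx
      have := hx.1
      simp only [mem_Ioi]; linarith
  have hk := kT_setIntegral hg hg0 h
  have hk' := mul_le_mul_of_nonneg_left hk hC
  have main : ∫ x in Ioi (0:ℝ), indicator (Icc (h + α) (h + β))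
      (fun _ => s * Real.exp (-σ * (h + β)) * (δ / 2)) x
      ≤ ∫ x in Ioi (0:ℝ), (S x * Real.exp (-σ * x) * kT φ h x
        + B * indicator (Ioc 0 x₁) (fun x => |S x|) x + C * kT φ h x) := by
    refine setIntegral_mono_on i3 ((i12).add (hkI.const_mul C)) measurableSet_Ioi
      fun x hx => ?_
    have hx0 : (0:ℝ) < x := hx
    have hk0 := kT_nonneg hg0 h x
    have hkB := (abs_le.1 (kT_bound hi h x)).2
    rw [← hB] at hkB
    have hE := Real.exp_pos (-σ * x)
    have hE1 : Real.exp (-σ * x) ≤ 1 := by rw [Real.exp_le_one_iff]; nlinarith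
    rcases le_or_gt x x₁ with hle | hgt
    · rw [indicator_of_notMem (fun hm => by linarith [hm.1]), indicator_of_mem (show x ∈ Ioc 0 x₁ from ⟨hx0, hle⟩)]
      have h1 : Real.exp (-σ * x) * kT φ h x ≤ 1 * B := mul_le_mul hE1 hkB hk0 zero_le_one
      have h2 := mul_le_mul_of_nonneg_left h1 (abs_nonneg (S x))
      have h3 := mul_le_mul_of_nonneg_right (neg_abs_le (S x)) (mul_nonneg hE.le hk0)
      nlinarith [mul_nonneg hC hk0]
    · rw [indicator_of_notMem (s := Ioc 0 x₁) (fun hm => by linarith [hm.2]), mul_zero, add_zero]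
      have hEx : Real.exp x * Real.exp (-σ * x) ≤ 1 := by
        rw [← Real.exp_add, Real.exp_le_one_iff]; nlinarith
      have h1 : (S x + C * Real.exp x) * Real.exp (-σ * x) * kT φ h x
          ≤ S x * Real.exp (-σ * x) * kT φ h x + C * kT φ h x := by
        have := mul_le_mul_of_nonneg_left hEx (mul_nonneg hC hk0)
        nlinarith
      refine le_trans ?_ h1
      by_cases hm : x ∈ Icc (h + α) (h + β)
      · rw [indicator_of_mem hm]
        have hd : δ / 2 ≤ kT φ h x := by
          have h2 := hδg (x - h) ⟨by linarith [hm.1], by linarith [hm.2]⟩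
          have h3 := hg0 (x + h)
          unfold kT
          linarith
        have he : Real.exp (-σ * (h + β)) ≤ Real.exp (-σ * x) := by
          apply Real.exp_le_exp.2
          nlinarith [hm.2]
        have hm1 := hmon x hm.1
        have hp := hpos x hgt.le
        gcongr
      · rw [indicator_of_notMem hm]
        exact mul_nonneg (mul_nonneg (hpos x hgt.le) hE.le) hk0
  rw [e3, integral_add i12 (hkI.const_mul C), integral_add i1 i2, integral_const_mul,
    integral_const_mul] at main
  linarith

lemma backward_dir {S φ : ℝ → ℝ} (hS : LocallyIntegrableOn S (Ici 0))
    (hc : Continuous φ) (hi : Integrable φ) (hg : Integrable (gT φ)) (hg0 : ∀ x, 0 ≤ gT φ x)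
    {x₀ : ℝ} (hx₀ : 0 < gT φ x₀) (hL : LogLinBoundedlyDecreasing S)
    (hint : ∀ s : ℂ, 1 < s.re →
      IntegrableOn (fun x : ℝ => Complex.exp (-s * x) * (S x : ℂ)) (Ioi 0))
    {σ : ℕ → ℝ} (hσ : ∀ n, 1 < σ n) (hσ1 : Tendsto σ atTop (nhds 1)) {J : ℝ → ℝ}
    (hJ : ∀ h : ℝ, 0 < h → Tendsto (fun n : ℕ =>
      ∫ t : ℝ, (laplaceT S (σ n + t * Complex.I)).re * φ t * Real.cos (h * t))
        atTop (nhds (J h)))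
    (hJO : J =O[atTop] (fun _ : ℝ => (1 : ℝ))) :
    (fun x : ℝ => S x) =O[atTop] (fun x : ℝ => Real.exp x) := by
  obtain ⟨C₀, x₁, hC₀, hx₁, hit⟩ := iterate_bound hL
  set C := C₀ + |S x₁| with hCdef
  have hC : 0 ≤ C := by positivity
  have hpos : ∀ x, x₁ ≤ x → 0 ≤ S x + C * Real.exp x := by
    intro x hx
    have h1 := hit x₁ x le_rfl hx
    have h2 : 1 ≤ Real.exp x := Real.one_le_exp (hx₁.trans hx)
    have h3 := neg_abs_le (S x₁)
    have h4 := le_mul_of_one_le_right (abs_nonneg (S x₁)) h2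
    rw [hCdef, add_mul]
    linarith
  have hmon : ∀ y x, x₁ ≤ y → y ≤ x → S y ≤ S x + C * Real.exp x := by
    intro y x hy hyx
    have h1 := hit y x hy hyx
    have h4 := mul_nonneg (abs_nonneg (S x₁)) (Real.exp_pos x).le
    rw [hCdef, add_mul]
    linarith
  obtain ⟨ε, hε, hball⟩ : ∃ ε > 0, ∀ x ∈ Icc (x₀ - ε) (x₀ + ε), gT φ x₀ / 2 ≤ gT φ x := by
    have h1 : ∀ᶠ x in nhds x₀, gT φ x₀ / 2 < gT φ x :=
      (gT_cont hc hi).continuousAt.eventually_const_lt (by linarith)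
    obtain ⟨ε, hε, h2⟩ := Metric.eventually_nhds_iff.1 h1
    refine ⟨ε / 2, by positivity, fun x hx => (h2 ?_).le⟩
    rw [Real.dist_eq, abs_lt]
    constructor <;> linarith [hx.1, hx.2]
  obtain ⟨K, hK⟩ := hJO.bound
  set δ := gT φ x₀ / 2 with hδ
  have hδ0 : 0 < δ := by positivity
  set α := x₀ - ε with hα
  set β := x₀ + ε with hβ
  have hαβ : 0 < β - α := by rw [hα, hβ]; linarith
  set A := (∫ t, |φ t|) * (∫ x in Ioi (0:ℝ), indicator (Ioc 0 x₁) (fun x => |S x|) x)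
        + C * ∫ x, gT φ x with hA
  set c := δ / 2 * (β - α) with hcdef
  have hc0 : 0 < c := by positivity
  -- the bound for every large `h`
  have main : ∀ᶠ h in atTop, |S (h + α)| ≤ max C ((K + A) / c * Real.exp (β - α)) * Real.exp (h + α) := by
    filter_upwards [hK, eventually_gt_atTop 0, eventually_gt_atTop (x₁ - α)] with h hKh hh0 hhx
    have hh : x₁ < h + α := by linarith
    set s := max 0 (S (h + α)) with hs
    have hs0 : 0 ≤ s := le_max_left _ _
    have hn : ∀ n, s * Real.exp (-σ n * (h + β)) * (δ / 2) * (β - α)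
        ≤ (∫ t : ℝ, (laplaceT S (σ n + t * Complex.I)).re * φ t * Real.cos (h * t)) + A := by
      intro n
      have hI := real_integrable (hint (σ n : ℂ) (by simpa using hσ n))
      rw [key_identity hc hi hI h]
      have hbi := backward_ineq hS hc hi hg hg0 hx₁ hC hδ0.le (by linarith) hball (hσ n) hI hpos hs0 hh
        (s := s) fun x hx => max_le (hpos x (by linarith)) (hmon _ x hh.le hx)
      linarith
    have hlim1 : Tendsto (fun n => s * Real.exp (-σ n * (h + β)) * (δ / 2) * (β - α)) atTop
        (nhds (s * Real.exp (-1 * (h + β)) * (δ / 2) * (β - α))) := by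
      have hcont : Continuous (fun u : ℝ => s * Real.exp (-u * (h + β)) * (δ / 2) * (β - α)) := by
        fun_prop
      exact (hcont.tendsto 1).comp hσ1
    have hle := le_of_tendsto_of_tendsto' hlim1 ((hJ h hh0).add_const A) hn
    have hJK : J h ≤ K := by
      have := (le_abs_self (J h)).trans hKh
      simpa using this
    have h5 : s ≤ (K + A) / c * Real.exp (h + β) := by
      have h6 : s * c ≤ (K + A) * Real.exp (h + β) := by
        have h7 : s * c * Real.exp (-1 * (h + β)) ≤ K + A := by
          rw [hcdef]
          linarith
        have h8 := mul_le_mul_of_nonneg_right h7 (Real.exp_pos (h + β)).le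
        rwa [mul_assoc, ← Real.exp_add, show -1 * (h + β) + (h + β) = 0 by ring, Real.exp_zero,
          mul_one] at h8
      rw [div_mul_eq_mul_div, le_div_iff₀ hc0]
      exact h6
    have h9 : Real.exp (h + β) = Real.exp (β - α) * Real.exp (h + α) := by
      rw [← Real.exp_add]; congr 1; ring
    rw [h9, ← mul_assoc] at h5
    have hE := (Real.exp_pos (h + α)).le
    rw [abs_le']
    constructor
    · exact (le_max_right _ _).trans (h5.trans
        (mul_le_mul_of_nonneg_right (le_max_right _ _) hE))
    · have := hpos (h + α) hh.le
      have h10 := mul_le_mul_of_nonneg_right (le_max_left C ((K + A) / c * Real.exp (β - α))) hE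
      linarith
  refine IsBigO.of_bound (max C ((K + A) / c * Real.exp (β - α))) ?_
  have hsh : Tendsto (fun y : ℝ => y + -α) atTop atTop := tendsto_atTop_add_const_right _ _ tendsto_id
  filter_upwards [hsh.eventually main] with y hy
  rw [neg_add_cancel_right] at hy
  simpa [abs_of_pos (Real.exp_pos y)] using hy

lemma forward_int {S : ℝ → ℝ} (hS : LocallyIntegrableOn S (Ici 0)) {C X : ℝ}
    (hC : 0 ≤ C) (hX : ∀ x, X ≤ x → |S x| ≤ C * Real.exp x) (s : ℂ) (hs : 1 < s.re) :
    IntegrableOn (fun x : ℝ => Complex.exp (-s * x) * (S x : ℂ)) (Ioi 0) := by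
  have hm : AEStronglyMeasurable S (volume.restrict (Ioi 0)) :=
    hS.aestronglyMeasurable.mono_measure (Measure.restrict_mono Ioi_subset_Ici_self le_rfl)
  have hb : IntegrableOn (fun x => indicator (Ioc 0 X) (fun x => |S x|) x
      + C * Real.exp (-(s.re - 1) * x)) (Ioi 0) :=
    (locInt_ind hS X).add ((exp_neg_integrableOn_Ioi 0 (by linarith)).const_mul C)
  refine hb.mono' ?_ ?_
  · exact (Continuous.aestronglyMeasurable (by fun_prop)).mul
      (Complex.continuous_ofReal.comp_aestronglyMeasurable hm)
  · refine (ae_restrict_iff' measurableSet_Ioi).2 (Eventually.of_forall fun x hx => ?_)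
    have hx0 : (0:ℝ) < x := hx
    rw [norm_mul, Complex.norm_exp, Complex.norm_real, Real.norm_eq_abs]
    have hre : (-s * (x:ℂ)).re = -s.re * x := by simp
    rw [hre]
    rcases le_or_gt x X with h | h
    · rw [indicator_of_mem (show x ∈ Ioc 0 X from ⟨hx0, h⟩)]
      have h1 : Real.exp (-s.re * x) ≤ 1 := by rw [Real.exp_le_one_iff]; nlinarith
      have h2 := mul_le_mul_of_nonneg_right h1 (abs_nonneg (S x))
      have h3 := mul_nonneg hC (Real.exp_pos (-(s.re - 1) * x)).le
      linarith
    · rw [indicator_of_notMem (fun hm => by linarith [hm.2]), zero_add]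
      have h1 := mul_le_mul_of_nonneg_left (hX x h.le) (Real.exp_pos (-s.re * x)).le
      have h2 : Real.exp (-(s.re - 1) * x) = Real.exp (-s.re * x) * Real.exp x := by
        rw [← Real.exp_add]; congr 1; ring
      rw [h2]
      linarith

lemma forward_dom {S φ : ℝ → ℝ} (hi : Integrable φ) (hg0 : ∀ x, 0 ≤ gT φ x) {C X : ℝ}
    (hC : 0 ≤ C) (hX : ∀ x, X ≤ x → |S x| ≤ C * Real.exp x) (h : ℝ) {σ : ℝ} (hσ : 1 ≤ σ)
    {x : ℝ} (hx : 0 < x) :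
    ‖S x * Real.exp (-σ * x) * kT φ h x‖
      ≤ (∫ t, |φ t|) * indicator (Ioc 0 X) (fun x => |S x|) x + C * kT φ h x := by
  have hk0 := kT_nonneg hg0 h x
  have hkB := (abs_le.1 (kT_bound hi h x)).2
  rw [norm_mul, norm_mul, Real.norm_eq_abs, Real.norm_eq_abs, Real.norm_eq_abs,
    abs_of_pos (Real.exp_pos _), abs_of_nonneg hk0]
  have hE := Real.exp_pos (-σ * x)
  have hE1 : Real.exp (-σ * x) ≤ 1 := by rw [Real.exp_le_one_iff]; nlinarith
  rcases le_or_gt x X with hle | hgt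
  · rw [indicator_of_mem (show x ∈ Ioc 0 X from ⟨hx, hle⟩)]
    have h1 : Real.exp (-σ * x) * kT φ h x ≤ 1 * ∫ t, |φ t| := mul_le_mul hE1 hkB hk0 zero_le_one
    have h2 := mul_le_mul_of_nonneg_left h1 (abs_nonneg (S x))
    nlinarith [mul_nonneg hC hk0]
  · rw [indicator_of_notMem (fun hm => by linarith [hm.2]), mul_zero, zero_add]
    have hEx : Real.exp x * Real.exp (-σ * x) ≤ 1 := by
      rw [← Real.exp_add, Real.exp_le_one_iff]; nlinarith
    have h1 := mul_le_mul_of_nonneg_right (hX x hgt.le) hE.le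
    have h2 := mul_le_mul_of_nonneg_left hEx hC
    exact mul_le_mul_of_nonneg_right (by linarith) hk0

lemma forward_loglin {S : ℝ → ℝ} {C X : ℝ}
    (hX : ∀ x, X ≤ x → |S x| ≤ C * Real.exp x) (hC : 0 ≤ C) : LogLinBoundedlyDecreasing S := by
  refine ⟨1, one_pos, -(C * (Real.exp 1 + 1)), X, fun x hx y hy => ?_⟩
  rw [le_div_iff₀ (Real.exp_pos x)]
  have h1 := abs_le.1 (hX x hx)
  have h2 := abs_le.1 (hX y (hx.trans hy.1))
  have h3 : Real.exp y ≤ Real.exp 1 * Real.exp x := by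
    rw [← Real.exp_add]; apply Real.exp_le_exp.2; linarith [hy.2]
  have h4 := mul_le_mul_of_nonneg_left h3 hC
  nlinarith [h1.2, h2.1]

lemma forward_dir {S φ : ℝ → ℝ} (hS : LocallyIntegrableOn S (Ici 0))
    (hc : Continuous φ) (hi : Integrable φ) (hg : Integrable (gT φ)) (hg0 : ∀ x, 0 ≤ gT φ x)
    (hO : (fun x : ℝ => S x) =O[atTop] (fun x : ℝ => Real.exp x)) :
    LogLinBoundedlyDecreasing S ∧
        (∀ s : ℂ, 1 < s.re →
          IntegrableOn (fun x : ℝ => Complex.exp (-s * x) * (S x : ℂ)) (Ioi 0)) ∧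
        ∃ σ : ℕ → ℝ, (∀ n, 1 < σ n) ∧ Tendsto σ atTop (nhds 1) ∧
          ∃ J : ℝ → ℝ,
            (∀ h : ℝ, 0 < h →
              Tendsto
                (fun n : ℕ =>
                  ∫ t : ℝ, (laplaceT S (σ n + t * Complex.I)).re * φ t * Real.cos (h * t))
                atTop (nhds (J h))) ∧
            J =O[atTop] (fun _ : ℝ => (1 : ℝ)) := by
  obtain ⟨C, hC, hOC⟩ := hO.exists_pos
  obtain ⟨X, hX'⟩ := eventually_atTop.1 hOC.bound
  have hX : ∀ x, X ≤ x → |S x| ≤ C * Real.exp x := by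
    intro x hx
    have := hX' x hx
    rwa [Real.norm_eq_abs, Real.norm_eq_abs, abs_of_pos (Real.exp_pos x)] at this
  have hint := forward_int hS hC.le hX
  have hσ : ∀ n : ℕ, (1:ℝ) < 1 + 1 / ((n:ℝ) + 1) := fun n => by
    have : 0 < 1 / ((n:ℝ) + 1) := by positivity
    linarith
  have hσ1 : Tendsto (fun n : ℕ => (1:ℝ) + 1 / ((n:ℝ) + 1)) atTop (nhds 1) := by
    simpa using (tendsto_one_div_add_atTop_nhds_zero_nat (𝕜 := ℝ)).const_add 1
  have hb : ∀ h, IntegrableOn (fun x => (∫ t, |φ t|) * indicator (Ioc 0 X) (fun x => |S x|) x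
      + C * kT φ h x) (Ioi 0) := fun h =>
    ((locInt_ind hS X).const_mul _).add ((kT_integrable hg h).integrableOn.const_mul C)
  refine ⟨forward_loglin hX hC.le, hint, fun n => 1 + 1 / ((n:ℝ) + 1), hσ, hσ1,
    fun h => ∫ x in Ioi (0:ℝ), S x * Real.exp (-1 * x) * kT φ h x, fun h _ => ?_, ?_⟩
  · have hI : ∀ n : ℕ, IntegrableOn (fun x : ℝ => S x * Real.exp (-(1 + 1 / ((n:ℝ) + 1)) * x)) (Ioi 0) :=
      fun n => real_integrable (hint ((1 + 1 / ((n:ℝ) + 1) : ℝ) : ℂ) (by rw [Complex.ofReal_re]; exact hσ n))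
    simp_rw [fun n => key_identity hc hi (hI n) h]
    refine tendsto_integral_of_dominated_convergence _ (fun n => ?_) (hb h) (fun n => ?_) ?_
    · exact (hI n).aestronglyMeasurable.mul (kT_cont hc hi h).aestronglyMeasurable
    · exact (ae_restrict_iff' measurableSet_Ioi).2 (Eventually.of_forall fun x hx =>
        forward_dom hi hg0 hC.le hX h (hσ n).le hx)
    · refine Eventually.of_forall fun x => ?_
      have hcont : Continuous (fun u : ℝ => S x * Real.exp (-u * x) * kT φ h x) := by fun_prop
      exact (hcont.tendsto 1).comp hσ1
  · refine IsBigO.of_bound ((∫ t, |φ t|) * (∫ x in Ioi (0:ℝ), indicator (Ioc 0 X) (fun x => |S x|) x)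
        + C * ∫ x, gT φ x) (Eventually.of_forall fun h => ?_)
    rw [norm_one, mul_one]
    refine (norm_integral_le_of_norm_le (hb h) ((ae_restrict_iff' measurableSet_Ioi).2
      (Eventually.of_forall fun x hx => forward_dom hi hg0 hC.le hX h le_rfl hx))).trans ?_
    rw [integral_add ((locInt_ind hS X).const_mul _) ((kT_integrable hg h).integrableOn.const_mul C),
      integral_const_mul, integral_const_mul]
    have := kT_setIntegral hg hg0 h
    gcongr

/-- Proposition 6.5: a characterization of `S(x) = O(eˣ)` through the boundary
behavior of the real part of the Laplace transform.  Here `φ` is a nonzero even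
real-valued compactly supported continuous function with non-negative Fourier
transform `φ̂(x) = ∫ φ(t) e^{-itx} dt` (which, since `φ` is even, equals
`∫ φ(t) cos(tx) dt`); in particular `φ` is in the Wiener algebra `A_c(ℝ)`. -/
theorem bigO_characterization (S : ℝ → ℝ)
    (hS : LocallyIntegrableOn S (Ici 0))
    (φ : ℝ → ℝ) (hφne : φ ≠ 0) (hφeven : ∀ t : ℝ, φ (-t) = φ t)
    (hφcont : Continuous φ) (hφsupp : HasCompactSupport φ)
    (hφhat : ∀ x : ℝ, 0 ≤ ∫ t : ℝ, φ t * Real.cos (t * x)) :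
    (fun x : ℝ => S x) =O[atTop] (fun x : ℝ => Real.exp x) ↔
      (LogLinBoundedlyDecreasing S ∧
        (∀ s : ℂ, 1 < s.re →
          IntegrableOn (fun x : ℝ => Complex.exp (-s * x) * (S x : ℂ)) (Ioi 0)) ∧
        ∃ σ : ℕ → ℝ, (∀ n, 1 < σ n) ∧ Tendsto σ atTop (nhds 1) ∧
          ∃ J : ℝ → ℝ,
            (∀ h : ℝ, 0 < h →
              Tendsto
                (fun n : ℕ =>
                  ∫ t : ℝ, (laplaceT S (σ n + t * Complex.I)).re * φ t * Real.cos (h * t))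
                atTop (nhds (J h))) ∧
            J =O[atTop] (fun _ : ℝ => (1 : ℝ))) := by
  have hi : Integrable φ := hφcont.integrable_of_hasCompactSupport hφsupp
  have hg0 : ∀ x, 0 ≤ gT φ x := hφhat
  have hg : Integrable (gT φ) := gT_integrable hφcont hφsupp hg0
  obtain ⟨x₀, hx₀⟩ := gT_ne hφcont hi hφeven hφne
  have hx₀' : 0 < gT φ x₀ := lt_of_le_of_ne (hg0 x₀) hx₀.symm
  constructor
  · exact forward_dir hS hφcont hi hg hg0
  · rintro ⟨hL, hint, σ, hσ, hσ1, J, hJ, hJO⟩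
    exact backward_dir hS hφcont hi hg hg0 hx₀' hL hint hσ hσ1 hJ hJO
end
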